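/- Hasse–Minkowski over ℚ: a quadratic form F(X₁,…,Xₙ) with rational coefficients is isotropic over ℚ (has a nontrivial zero in ℚ^n) if and only if it is isotropic over ℝ and over ℚ_p for every prime p. -/

import Mathlib

/-- isotropy of a ternary diagonal form -/
def Tern (K : Type*) [Field K] (a b c : K) : Prop :=
  ∃ x y z : K, (x ≠ 0 ∨ y ≠ 0 ∨ z ≠ 0) ∧ a * x ^ 2 + b * y ^ 2 + c * z ^ 2 = 0

section tern
variable {K : Type*} [Field K]

lemma Tern.rot {a b c : K} (h : Tern K a b c) : Tern K b c a := by
  obtain ⟨x, y, z, h0, h⟩ := h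
  exact ⟨y, z, x, by tauto, by linear_combination h⟩

lemma Tern.swap {a b c : K} (h : Tern K a b c) : Tern K b a c := by
  obtain ⟨x, y, z, h0, h⟩ := h
  exact ⟨y, x, z, by tauto, by linear_combination h⟩

lemma Tern.smul {a b c : K} (k : K) (h : Tern K a b c) : Tern K (k * a) (k * b) (k * c) := by
  obtain ⟨x, y, z, h0, h⟩ := h
  exact ⟨x, y, z, h0, by linear_combination k * h⟩

lemma Tern.sq3 {a b c s : K} (hs : s ≠ 0) (h : Tern K a b c) : Tern K a b (c * s ^ 2) := by
  obtain ⟨x, y, z, h0, h⟩ := h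
  refine ⟨x, y, z / s, ?_, ?_⟩
  · simpa [hs] using h0
  · field_simp
    linear_combination h

lemma Tern.sq {a b c r s t : K} (hr : r ≠ 0) (hs : s ≠ 0) (ht : t ≠ 0) (h : Tern K a b c) :
    Tern K (a * r ^ 2) (b * s ^ 2) (c * t ^ 2) :=
  ((((h.sq3 ht).rot.sq3 hr).rot).sq3 hs).rot

lemma Tern.norm {a b b' t : K} (hb : b ≠ 0) (hb' : b' ≠ 0) (e : b * b' = t ^ 2 - a)
    (h : Tern K 1 (-a) (-b)) : Tern K 1 (-a) (-b') := by
  obtain ⟨x, y, z, h0, h⟩ := h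
  refine ⟨x * t + a * y, x + t * y, b * z, ?_, ?_⟩
  · by_contra! hc
    obtain ⟨h1, h2, h3⟩ := hc
    have hz : z = 0 := by simpa [hb] using h3
    have hd : t ^ 2 - a ≠ 0 := by rw [← e]; exact mul_ne_zero hb hb'
    have hy : (t ^ 2 - a) * y = 0 := by linear_combination t * h2 - h1
    have hy : y = 0 := by simpa [hd] using hy
    have hx : x = 0 := by simpa [hy] using h2
    simp_all
  · linear_combination (t ^ 2 - a) * h - b * z ^ 2 * e

end tern

section padic
variable {p : ℕ} [hp : Fact p.Prime]

lemma padic_prim_aux {a b c : ℤ} {x y z : ℚ_[p]} (hx : x ≠ 0) (hy : ‖y‖ ≤ ‖x‖) (hz : ‖z‖ ≤ ‖x‖)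
    (h : (a : ℚ_[p]) * x ^ 2 + b * y ^ 2 + c * z ^ 2 = 0) :
    ∃ y z : ℤ_[p], (a : ℤ_[p]) + b * y ^ 2 + c * z ^ 2 = 0 := by
  have hx' : 0 < ‖x‖ := norm_pos_iff.2 hx
  obtain ⟨Y, hY⟩ : ∃ Y : ℤ_[p], (Y : ℚ_[p]) = y / x :=
    ⟨⟨y / x, by rw [norm_div]; exact (div_le_one hx').2 hy⟩, rfl⟩
  obtain ⟨Z, hZ⟩ : ∃ Z : ℤ_[p], (Z : ℚ_[p]) = z / x :=
    ⟨⟨z / x, by rw [norm_div]; exact (div_le_one hx').2 hz⟩, rfl⟩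
  refine ⟨Y, Z, ?_⟩
  apply Subtype.ext
  push_cast
  rw [hY, hZ]
  field_simp
  linear_combination h

lemma padic_prim {a b c : ℤ} (h : Tern ℚ_[p] a b c) :
    ∃ x y z : ℤ_[p], (x = 1 ∨ y = 1 ∨ z = 1) ∧ (a : ℤ_[p]) * x ^ 2 + b * y ^ 2 + c * z ^ 2 = 0 := by
  obtain ⟨x, y, z, h0, h⟩ := h
  have key : (x ≠ 0 ∧ ‖y‖ ≤ ‖x‖ ∧ ‖z‖ ≤ ‖x‖) ∨ (y ≠ 0 ∧ ‖x‖ ≤ ‖y‖ ∧ ‖z‖ ≤ ‖y‖) ∨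
      (z ≠ 0 ∧ ‖x‖ ≤ ‖z‖ ∧ ‖y‖ ≤ ‖z‖) := by
    simp only [← norm_pos_iff] at h0 ⊢
    have := norm_nonneg x
    have := norm_nonneg y
    have := norm_nonneg z
    grind
  rcases key with ⟨h1, h2, h3⟩ | ⟨h1, h2, h3⟩ | ⟨h1, h2, h3⟩
  · obtain ⟨y, z, h⟩ := padic_prim_aux h1 h2 h3 h
    exact ⟨1, y, z, by simp, by linear_combination h⟩
  · obtain ⟨y, z, h⟩ := padic_prim_aux (a := b) (b := a) (c := c) h1 h2 h3 (by linear_combination h)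
    exact ⟨y, 1, z, by simp, by linear_combination h⟩
  · obtain ⟨y, z, h⟩ := padic_prim_aux (a := c) (b := a) (c := b) h1 h2 h3 (by linear_combination h)
    exact ⟨y, z, 1, by simp, by linear_combination h⟩

lemma toZMod_eq_zero_iff (x : ℤ_[p]) : PadicInt.toZMod x = 0 ↔ (p : ℤ_[p]) ∣ x := by
  rw [← RingHom.mem_ker, PadicInt.ker_toZMod, PadicInt.maximalIdeal_eq_span_p,
    Ideal.mem_span_singleton]

/-- local condition at `p ∣ a`. -/
lemma local_cond {a b c : ℤ} (ha : (p : ℤ) ∣ a) (ha2 : ¬ (p : ℤ) ^ 2 ∣ a) (hb : ¬ (p : ℤ) ∣ b)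
    (hc : ¬ (p : ℤ) ∣ c) (h : Tern ℚ_[p] a b c) : IsSquare (((-(b * c) : ℤ)) : ZMod p) := by
  obtain ⟨x, y, z, h0, h⟩ := padic_prim h
  have hb' : ((b : ℤ) : ZMod p) ≠ 0 := by rwa [Ne, ZMod.intCast_zmod_eq_zero_iff_dvd]
  have hc' : ((c : ℤ) : ZMod p) ≠ 0 := by rwa [Ne, ZMod.intCast_zmod_eq_zero_iff_dvd]
  have ha' : ((a : ℤ) : ZMod p) = 0 := by rwa [ZMod.intCast_zmod_eq_zero_iff_dvd]
  have h1 := congrArg (PadicInt.toZMod (p := p)) h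
  simp only [map_add, map_mul, map_pow, map_intCast, map_zero, ha', zero_mul, zero_add] at h1
  by_cases hz : PadicInt.toZMod z = 0
  · exfalso
    have hy : PadicInt.toZMod y = 0 := by simpa [hz, hb'] using h1
    obtain ⟨y', rfl⟩ := (toZMod_eq_zero_iff _).1 hy
    obtain ⟨z', rfl⟩ := (toZMod_eq_zero_iff _).1 hz
    obtain ⟨a', rfl⟩ := ha
    have hp0 : (p : ℤ_[p]) ≠ 0 := by exact_mod_cast hp.1.ne_zero
    have h2 : (a' : ℤ_[p]) * x ^ 2 + p * (b * y' ^ 2 + c * z' ^ 2) = 0 := by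
      apply mul_left_cancel₀ hp0
      push_cast at h
      linear_combination h
    have h3 := congrArg (PadicInt.toZMod (p := p)) h2
    simp only [map_add, map_mul, map_pow, map_intCast, map_zero, map_natCast, CharP.cast_eq_zero,
      zero_mul, add_zero] at h3
    have ha3 : ((a' : ℤ) : ZMod p) ≠ 0 := by
      rw [Ne, ZMod.intCast_zmod_eq_zero_iff_dvd]
      intro hd
      apply ha2
      rw [pow_two]
      exact mul_dvd_mul_left _ hd
    have hx : PadicInt.toZMod x = 0 := by simpa [ha3] using h3
    rcases h0 with rfl | h0 | h0
    · simp at hx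
    · rw [h0] at hy; simp at hy
    · rw [h0] at hz; simp at hz
  · refine ⟨b * PadicInt.toZMod y / PadicInt.toZMod z, ?_⟩
    push_cast
    field_simp
    linear_combination (-1 : ZMod p) * h1

lemma isSquare_near_one {u : ℚ_[p]} (h : ‖u - 1‖ < ‖(2 : ℚ_[p])‖ ^ 2) : IsSquare u := by
  have h2 : ‖(2 : ℚ_[p])‖ ≤ 1 := by simpa using Padic.norm_int_le_one (p := p) 2
  have hu : ‖u‖ ≤ 1 := by
    have : u = (u - 1) + 1 := by ring
    rw [this]
    refine (Padic.nonarchimedean _ _).trans (max_le ?_ (by simp))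
    exact h.le.trans (pow_le_one₀ (norm_nonneg _) h2)
  let U : ℤ_[p] := ⟨u, hu⟩
  obtain ⟨z, hz, -⟩ := hensels_lemma (p := p) (R := ℤ_[p]) (F := Polynomial.X ^ 2 - Polynomial.C U) (a := 1) (by
    simp
    have : ‖(1 : ℤ_[p]) - U‖ = ‖u - 1‖ := by
      rw [norm_sub_rev]; rfl
    rw [this]
    have h3 : ‖(1 + 1 : ℤ_[p])‖ = ‖(2 : ℚ_[p])‖ := by
      rw [one_add_one_eq_two]; rfl
    first
      | exact h
      | (rw [h3]; exact h)
      | (convert h using 2))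
  refine ⟨(z : ℚ_[p]), ?_⟩
  simp at hz
  have h4 : z ^ 2 = U := sub_eq_zero.1 hz
  have h5 : ((z ^ 2 : ℤ_[p]) : ℚ_[p]) = u := by rw [h4]
  rw [← h5]
  push_cast
  ring

lemma toZMod_ne_zero_of_norm {x : ℤ_[p]} (h : ‖x‖ = 1) : PadicInt.toZMod x ≠ 0 := by
  rw [Ne, toZMod_eq_zero_iff, ← PadicInt.norm_lt_one_iff_dvd, h]
  simp

lemma norm_of_toZMod_ne_zero {x : ℤ_[p]} (h : PadicInt.toZMod x ≠ 0) : ‖x‖ = 1 := by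
  rw [Ne, toZMod_eq_zero_iff, ← PadicInt.norm_lt_one_iff_dvd, not_lt] at h
  exact le_antisymm (PadicInt.norm_le_one x) h

lemma norm_two_of_ne {p : ℕ} [hp : Fact p.Prime] (hp2 : p ≠ 2) : ‖(2 : ℚ_[p])‖ = 1 := by
  have : ‖((2 : ℕ) : ℚ_[p])‖ = 1 := by
    rw [Padic.norm_natCast_eq_one_iff]
    exact (Nat.coprime_primes hp.1 Nat.prime_two).2 hp2
  simpa using this

lemma tern_unit_aux {a b c x y : ℤ_[p]} (hp2 : p ≠ 2) (ha : ‖a‖ = 1) (hx : ‖x‖ = 1)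
    (h : PadicInt.toZMod (a * x ^ 2 + b * y ^ 2 + c) = 0) :
    Tern ℚ_[p] a b c := by
  rw [toZMod_eq_zero_iff, ← PadicInt.norm_lt_one_iff_dvd] at h
  have ha' : ‖(a : ℚ_[p])‖ = 1 := ha
  have hx' : ‖(x : ℚ_[p])‖ = 1 := hx
  have h' : ‖(a : ℚ_[p]) * x ^ 2 + b * y ^ 2 + c‖ < 1 := by
    have := h
    rw [PadicInt.norm_def] at this
    push_cast at this
    exact this
  have ha0 : (a : ℚ_[p]) ≠ 0 := by
    rw [← norm_pos_iff, ha']; norm_num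
  have hx0 : (x : ℚ_[p]) ≠ 0 := by
    rw [← norm_pos_iff, hx']; norm_num
  have hu : IsSquare (-(c + b * y ^ 2) / (a * x ^ 2) : ℚ_[p]) := by
    apply isSquare_near_one
    have : (-(c + b * y ^ 2) / (a * x ^ 2) - 1 : ℚ_[p]) =
      -(a * x ^ 2 + b * y ^ 2 + c) / (a * x ^ 2) := by field_simp; ring
    rw [this, norm_two_of_ne hp2, norm_div, norm_neg, norm_mul, norm_pow, ha', hx']
    simpa using h'
  obtain ⟨w, hw⟩ := hu
  refine ⟨x * w, y, 1, by simp, ?_⟩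
  have : (-(c + b * y ^ 2) : ℚ_[p]) = w * w * (a * x ^ 2) := by
    rw [← hw]; field_simp
  linear_combination -this

lemma tern_unit {a b c : ℚ_[p]} (hp2 : p ≠ 2) (ha : ‖a‖ = 1) (hb : ‖b‖ = 1) (hc : ‖c‖ = 1) :
    Tern ℚ_[p] a b c := by
  obtain ⟨A, rfl⟩ : ∃ A : ℤ_[p], (A : ℚ_[p]) = a := ⟨⟨a, ha.le⟩, rfl⟩
  obtain ⟨B, rfl⟩ : ∃ A : ℤ_[p], (A : ℚ_[p]) = b := ⟨⟨b, hb.le⟩, rfl⟩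
  obtain ⟨C, rfl⟩ : ∃ A : ℤ_[p], (A : ℚ_[p]) = c := ⟨⟨c, hc.le⟩, rfl⟩
  have hA := toZMod_ne_zero_of_norm (x := A) ha
  have hB := toZMod_ne_zero_of_norm (x := B) hb
  have hC := toZMod_ne_zero_of_norm (x := C) hc
  obtain ⟨x, y, hxy⟩ := FiniteField.exists_root_sum_quadratic (R := ZMod p)
    (f := Polynomial.C (PadicInt.toZMod A) * Polynomial.X ^ 2 + Polynomial.C 0 * Polynomial.X
      + Polynomial.C 0)
    (g := Polynomial.C (PadicInt.toZMod B) * Polynomial.X ^ 2 + Polynomial.C 0 * Polynomial.X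
      + Polynomial.C (PadicInt.toZMod C))
    (Polynomial.degree_quadratic hA) (Polynomial.degree_quadratic hB)
    (by rw [ZMod.card]; exact (hp.1.eq_two_or_odd).resolve_left hp2)
  simp at hxy
  obtain ⟨X, rfl⟩ := ZMod.ringHom_surjective (PadicInt.toZMod (p := p)) x
  obtain ⟨Y, rfl⟩ := ZMod.ringHom_surjective (PadicInt.toZMod (p := p)) y
  by_cases hX : PadicInt.toZMod X = 0
  · have hY : PadicInt.toZMod Y ≠ 0 := by
      intro hY
      simp [hX, hY, hC] at hxy
    apply Tern.swap
    apply tern_unit_aux (x := Y) (y := X) hp2 hb (norm_of_toZMod_ne_zero hY)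
    simp only [map_add, map_mul, map_pow]
    linear_combination hxy
  · apply tern_unit_aux (x := X) (y := Y) hp2 ha (norm_of_toZMod_ne_zero hX)
    simp only [map_add, map_mul, map_pow]
    linear_combination hxy

end padic


open NumberTheorySymbols

def k4 (n : ℕ) : ℤ := if n % 4 = 3 then -1 else 1
def k8 (n : ℕ) : ℤ := if n % 8 = 3 ∨ n % 8 = 5 then -1 else 1
def k44 (m n : ℕ) : ℤ := if m % 4 = 3 ∧ n % 4 = 3 then -1 else 1
def ks (s : Bool) (n : ℕ) : ℤ := if s then k4 n else 1
def sg (s : Bool) : ℤ := if s then -1 else 1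

def ktot (sa sb sc e : Bool) (A B C : ℕ) : ℤ :=
  ks (sb == sc) A * ks (sa == sc) B * ks (sa == sb) C * (if e then k8 B * k8 C else 1) *
    (k44 A B * k44 A C * k44 B C)

set_option maxRecDepth 100000 in
set_option maxHeartbeats 4000000 in
lemma ktot_dec : ∀ A ∈ [(1 : ℕ), 3, 5, 7], ∀ B ∈ [(1 : ℕ), 3, 5, 7], ∀ C ∈ [(1 : ℕ), 3, 5, 7], ∀ sa sb sc : Bool,
    ¬ (sa = sb ∧ sb = sc) →
    ((4 ∣ sg sa * A + sg sb * B ∨ 4 ∣ sg sb * B + sg sc * C ∨ 4 ∣ sg sa * A + sg sc * C) →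
      ktot sa sb sc false A B C = 1) ∧
    ((8 ∣ sg sb * B + sg sc * C ∨ 8 ∣ 2 * (sg sa * A) + sg sb * B + sg sc * C) →
      ktot sa sb sc true A B C = 1) := by
  decide

lemma J_neg_one {A : ℕ} (hA : Odd A) : J(-1 | A) = k4 A := by
  rw [jacobiSym.at_neg_one hA, ZMod.χ₄_nat_eq_if_mod_four, k4]
  have := Nat.odd_iff.1 hA
  split_ifs <;> first | rfl | omega

lemma J_two {A : ℕ} (hA : Odd A) : J(2 | A) = k8 A := by
  rw [jacobiSym.at_two hA, ZMod.χ₈_nat_eq_if_mod_eight, k8]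
  have := Nat.odd_iff.1 hA
  split_ifs <;> first | rfl | omega

lemma J_rec {A B : ℕ} (hA : Odd A) (hB : Odd B) (h : A.Coprime B) :
    J(A | B) * J(B | A) = k44 A B := by
  rw [← jacobiSym.quadratic_reciprocity_if (Nat.odd_iff.1 hA) (Nat.odd_iff.1 hB)]
  have h1 : J(B | A) ^ 2 = 1 := jacobiSym.sq_one (by simpa [Int.gcd_natCast_natCast] using h.symm)
  rw [k44]
  split_ifs <;> linarith [h1, sq J(B | A)]

lemma J_neg_sg {A : ℕ} (hA : Odd A) (s t : Bool) : J(-(sg s * sg t) | A) = ks (s == t) A := by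
  cases s <;> cases t <;> simp [sg, ks, J_neg_one hA, jacobiSym.one_left]

lemma recip_core {A B C : ℕ} (hA : Odd A) (hB : Odd B) (hC : Odd C) (hAB : A.Coprime B)
    (hAC : A.Coprime C) (hBC : B.Coprime C) (sa sb sc e : Bool) (hs : ¬ (sa = sb ∧ sb = sc))
    (a b c : ℤ) (ha : a = sg sa * (if e then 2 else 1) * A) (hb : b = sg sb * B)
    (hc : c = sg sc * C)
    (h0 : e = false → 4 ∣ a + b ∨ 4 ∣ b + c ∨ 4 ∣ a + c)
    (h1 : e = true → 8 ∣ b + c ∨ 8 ∣ a + b + c) :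
    J(-(b * c) | A) * J(-(a * c) | B) * J(-(a * b) | C) = 1 := by
  have e1 : J(-(b * c) | A) = ks (sb == sc) A * (J(B | A) * J(C | A)) := by
    rw [hb, hc, show -(sg sb * (B : ℤ) * (sg sc * C)) = -(sg sb * sg sc) * (B * C) by ring,
      jacobiSym.mul_left, jacobiSym.mul_left, J_neg_sg hA]
  have e2 : J(-(a * c) | B) = ks (sa == sc) B * ((if e then k8 B else 1) * J(A | B) * J(C | B)) := by
    rw [ha, hc, show -(sg sa * (if e then 2 else 1) * (A : ℤ) * (sg sc * C)) =
      -(sg sa * sg sc) * ((if e then 2 else 1) * A * C) by ring,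
      jacobiSym.mul_left, jacobiSym.mul_left, jacobiSym.mul_left, J_neg_sg hB]
    cases e <;> simp [J_two hB, jacobiSym.one_left]
  have e3 : J(-(a * b) | C) = ks (sa == sb) C * ((if e then k8 C else 1) * J(A | C) * J(B | C)) := by
    rw [ha, hb, show -(sg sa * (if e then 2 else 1) * (A : ℤ) * (sg sb * B)) =
      -(sg sa * sg sb) * ((if e then 2 else 1) * A * B) by ring,
      jacobiSym.mul_left, jacobiSym.mul_left, jacobiSym.mul_left, J_neg_sg hC]
    cases e <;> simp [J_two hC, jacobiSym.one_left]
  have e4 : J(-(b * c) | A) * J(-(a * c) | B) * J(-(a * b) | C) = ktot sa sb sc e A B C := by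
    rw [e1, e2, e3, ktot, ← J_rec hA hB hAB, ← J_rec hA hC hAC, ← J_rec hB hC hBC]
    cases e <;> simp <;> ring
  rw [e4]
  have e5 : ktot sa sb sc e A B C = ktot sa sb sc e (A % 8) (B % 8) (C % 8) := by
    have h4 (n : ℕ) : n % 8 % 4 = n % 4 := by omega
    simp [ktot, ks, k4, k8, k44, h4]
  rw [e5]
  have hm (n : ℕ) (hn : Odd n) : n % 8 ∈ [1, 3, 5, 7] := by
    have := Nat.odd_iff.1 hn
    simp
    omega
  have key := ktot_dec _ (hm A hA) _ (hm B hB) _ (hm C hC) sa sb sc hs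
  cases e
  · apply key.1
    have := h0 rfl
    simp only [ha, hb, hc] at this
    revert this
    cases sa <;> cases sb <;> cases sc <;> simp [sg] <;> omega
  · apply key.2
    have := h1 rfl
    simp only [ha, hb, hc] at this
    revert this
    cases sa <;> cases sb <;> cases sc <;> simp [sg] <;> omega

lemma zmod8_sq (x : ZMod 8) : (x ^ 2 = ((0 : ℤ) : ZMod 8) ∨ x ^ 2 = ((1 : ℤ) : ZMod 8) ∨
    x ^ 2 = ((4 : ℤ) : ZMod 8)) := by
  revert x; decide

lemma two_adic {a b c : ℤ} (h : Tern ℚ_[2] a b c) :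
    ∃ X Y Z : ℤ, (X = 0 ∨ X = 1 ∨ X = 4) ∧ (Y = 0 ∨ Y = 1 ∨ Y = 4) ∧ (Z = 0 ∨ Z = 1 ∨ Z = 4) ∧
      (X = 1 ∨ Y = 1 ∨ Z = 1) ∧ 8 ∣ a * X + b * Y + c * Z := by
  obtain ⟨x, y, z, h0, h⟩ := padic_prim h
  have key (x : ℤ_[2]) : ∃ X : ℤ, (X = 0 ∨ X = 1 ∨ X = 4) ∧ (x = 1 → X = 1) ∧
      (PadicInt.toZModPow 3 x) ^ 2 = ((X : ℤ) : ZMod (2 ^ 3)) := by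
    by_cases hx : x = 1
    · exact ⟨1, by simp, by simp, by simp [hx]⟩
    · rcases zmod8_sq (PadicInt.toZModPow 3 x) with h | h | h
      · exact ⟨0, by simp, by simp [hx], h⟩
      · exact ⟨1, by simp, by simp [hx], h⟩
      · exact ⟨4, by simp, by simp [hx], h⟩
  obtain ⟨X, hX, hX1, hX2⟩ := key x
  obtain ⟨Y, hY, hY1, hY2⟩ := key y
  obtain ⟨Z, hZ, hZ1, hZ2⟩ := key z
  refine ⟨X, Y, Z, hX, hY, hZ, by tauto, ?_⟩
  have h1 := congrArg (PadicInt.toZModPow (p := 2) 3) h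
  simp only [map_add, map_mul, map_pow, map_intCast, map_zero, hX2, hY2, hZ2] at h1
  have h2 : ((a * X + b * Y + c * Z : ℤ) : ZMod (2 ^ 3)) = 0 := by
    push_cast; exact h1
  rw [ZMod.intCast_zmod_eq_zero_iff_dvd] at h2
  simpa using h2

def od (a : ℤ) : ℕ := if 2 ∣ a then a.natAbs / 2 else a.natAbs

lemma sg_repr (a : ℤ) (ha0 : a ≠ 0) (ha : ¬ 4 ∣ a) :
    Odd (od a) ∧ ((decide (a < 0) = true) ↔ a < 0) ∧
    a = sg (decide (a < 0)) * (if decide ((2 : ℤ) ∣ a) then 2 else 1) * od a := by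
  refine ⟨?_, by simp, ?_⟩
  · rw [Nat.odd_iff, od]; split_ifs <;> omega
  · by_cases h : a < 0 <;> by_cases h2 : 2 ∣ a <;>
      simp only [sg, od, h, h2, decide_true, decide_false, if_true, if_false, Bool.false_eq_true]
        <;> omega

lemma od_dvd (a : ℤ) : od a ∣ a.natAbs := by
  rw [od]; split_ifs with h
  · exact Nat.div_dvd_of_dvd (by omega)
  · exact dvd_rfl

lemma od_coprime {a b : ℤ} (h : IsCoprime a b) : (od a).Coprime (od b) := by
  have := Int.isCoprime_iff_gcd_eq_one.1 h
  exact Nat.Coprime.of_dvd (od_dvd a) (od_dvd b) this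

lemma two_adic_odd {a b c X Y Z : ℤ} (ha : ¬ 2 ∣ a) (hb : ¬ 2 ∣ b) (hc : ¬ 2 ∣ c)
    (hX : X = 0 ∨ X = 1 ∨ X = 4) (hY : Y = 0 ∨ Y = 1 ∨ Y = 4) (hZ : Z = 0 ∨ Z = 1 ∨ Z = 4)
    (h1 : X = 1 ∨ Y = 1 ∨ Z = 1) (hd : 8 ∣ a * X + b * Y + c * Z) :
    4 ∣ a + b ∨ 4 ∣ b + c ∨ 4 ∣ a + c := by
  have hd4 : 4 ∣ a * X + b * Y + c * Z := dvd_trans (by norm_num) hd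
  clear hd
  rcases hX with rfl | rfl | rfl <;> rcases hY with rfl | rfl | rfl <;>
    rcases hZ with rfl | rfl | rfl <;> norm_num at h1 <;> omega

lemma two_adic_even {a b c X Y Z : ℤ} (ha4 : ¬ 4 ∣ a) (ha : 2 ∣ a) (hb : ¬ 2 ∣ b) (hc : ¬ 2 ∣ c)
    (hX : X = 0 ∨ X = 1 ∨ X = 4) (hY : Y = 0 ∨ Y = 1 ∨ Y = 4) (hZ : Z = 0 ∨ Z = 1 ∨ Z = 4)
    (h1 : X = 1 ∨ Y = 1 ∨ Z = 1) (hd : 8 ∣ a * X + b * Y + c * Z) :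
    8 ∣ b + c ∨ 8 ∣ a + b + c := by
  obtain ⟨a, rfl⟩ := ha
  rcases hX with rfl | rfl | rfl <;> rcases hY with rfl | rfl | rfl <;>
    rcases hZ with rfl | rfl | rfl <;> norm_num at h1 <;> omega

lemma recip_odd {a b c : ℤ} (ha0 : a ≠ 0) (ha : ¬ 4 ∣ a) (hb : ¬ 2 ∣ b) (hc : ¬ 2 ∣ c)
    (hab : IsCoprime a b) (hac : IsCoprime a c) (hbc : IsCoprime b c)
    (hR : ¬ (0 < a ∧ 0 < b ∧ 0 < c)) (hR' : ¬ (a < 0 ∧ b < 0 ∧ c < 0))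
    (h2 : Tern ℚ_[2] a b c) :
    J(-(b * c) | od a) * J(-(a * c) | od b) * J(-(a * b) | od c) = 1 := by
  have hb0 : b ≠ 0 := by omega
  have hc0 : c ≠ 0 := by omega
  obtain ⟨oa, sa, ea⟩ := sg_repr a ha0 ha
  obtain ⟨ob, sb, eb⟩ := sg_repr b hb0 (by omega)
  obtain ⟨oc, sc, ec⟩ := sg_repr c hc0 (by omega)
  obtain ⟨X, Y, Z, hX, hY, hZ, h1, hd⟩ := two_adic h2
  refine recip_core oa ob oc (od_coprime hab) (od_coprime hac) (od_coprime hbc)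
    (decide (a < 0)) (decide (b < 0)) (decide (c < 0)) (decide (2 ∣ a)) ?_ a b c ea
    (by simpa [hb] using eb) (by simpa [hc] using ec) ?_ ?_
  · rintro ⟨h3, h4⟩
    rw [Bool.eq_iff_iff, sa, sb] at h3
    rw [Bool.eq_iff_iff, sb, sc] at h4
    by_cases h : a < 0
    · exact hR' ⟨h, h3.1 h, h4.1 (h3.1 h)⟩
    · apply hR
      have : ¬ b < 0 := fun hh => h (h3.2 hh)
      have : ¬ c < 0 := fun hh => h (h3.2 (h4.2 hh))
      omega
  · intro h
    have h : ¬ 2 ∣ a := by simpa using h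
    exact two_adic_odd h hb hc hX hY hZ h1 hd
  · intro h
    have h : 2 ∣ a := by simpa using h
    exact two_adic_even ha h hb hc hX hY hZ h1 hd

lemma not_two_dvd_of {a b : ℤ} (h : IsCoprime a b) (ha : 2 ∣ a) : ¬ 2 ∣ b := by
  intro hb
  have := h.isUnit_of_dvd' ha hb
  rw [Int.isUnit_iff] at this
  omega

lemma not_four_dvd {a : ℤ} (h : Squarefree a) : ¬ 4 ∣ a := by
  intro h4
  have := h 2 (by norm_num; exact h4)
  rw [Int.isUnit_iff] at this
  omega

lemma recip_prod {a b c : ℤ} (ha : Squarefree a) (hb : Squarefree b) (hc : Squarefree c)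
    (hab : IsCoprime a b) (hac : IsCoprime a c) (hbc : IsCoprime b c)
    (hR : Tern ℝ a b c) (h2 : Tern ℚ_[2] a b c) :
    J(-(b * c) | od a) * J(-(a * c) | od b) * J(-(a * b) | od c) = 1 := by
  have hR1 : ¬ (0 < a ∧ 0 < b ∧ 0 < c) := by
    rintro ⟨h1, h2, h3⟩
    obtain ⟨x, y, z, h0, h⟩ := hR
    have h1 : (0 : ℝ) < a := by exact_mod_cast h1
    have h2 : (0 : ℝ) < b := by exact_mod_cast h2
    have h3 : (0 : ℝ) < c := by exact_mod_cast h3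
    rcases h0 with h0 | h0 | h0 <;> have := sq_pos_of_ne_zero h0 <;>
    · have := mul_pos h1 this
      have := mul_pos h2 this
      have := mul_pos h3 this
      nlinarith [mul_nonneg h1.le (sq_nonneg x), mul_nonneg h2.le (sq_nonneg y),
        mul_nonneg h3.le (sq_nonneg z), mul_pos h1 (sq_pos_of_ne_zero h0),
        mul_pos h2 (sq_pos_of_ne_zero h0), mul_pos h3 (sq_pos_of_ne_zero h0)]
  have hR2 : ¬ (a < 0 ∧ b < 0 ∧ c < 0) := by
    rintro ⟨h1, h2, h3⟩
    obtain ⟨x, y, z, h0, h⟩ := hR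
    have h1 : (0 : ℝ) < -a := by simpa using h1
    have h2 : (0 : ℝ) < -b := by simpa using h2
    have h3 : (0 : ℝ) < -c := by simpa using h3
    rcases h0 with h0 | h0 | h0 <;>
      nlinarith [mul_nonneg h1.le (sq_nonneg x), mul_nonneg h2.le (sq_nonneg y),
        mul_nonneg h3.le (sq_nonneg z), mul_pos h1 (sq_pos_of_ne_zero h0),
        mul_pos h2 (sq_pos_of_ne_zero h0), mul_pos h3 (sq_pos_of_ne_zero h0)]
  by_cases hb2 : 2 ∣ b
  · have := recip_odd hb.ne_zero (not_four_dvd hb) (not_two_dvd_of hbc hb2)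
      (not_two_dvd_of hab.symm hb2) hbc hab.symm hac.symm (by tauto) (by tauto) h2.rot
    rw [mul_comm c a, mul_comm b a, mul_comm] at this
    rw [← this]; ring
  by_cases hc2 : 2 ∣ c
  · have := recip_odd hc.ne_zero (not_four_dvd hc) (not_two_dvd_of hac.symm hc2)
      (not_two_dvd_of hbc.symm hc2) hac.symm hbc.symm hab (by tauto) (by tauto) h2.rot.rot
    rw [mul_comm c a, mul_comm c b] at this
    rw [← this]; ring
  exact recip_odd ha.ne_zero (not_four_dvd ha) hb2 hc2 hab hac hbc hR1 hR2 h2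

lemma jac_one {x : ℤ} {n : ℕ} (hn : n ≠ 0) (h : ∀ p : ℕ, p.Prime → p ∣ n → J(x | p) = 1) :
    J(x | n) = 1 := by
  induction n using Nat.strong_induction_on with
  | _ n ih =>
  by_cases h1 : n = 1
  · subst h1; simp
  · have hp := Nat.minFac_prime h1
    obtain ⟨m, hm⟩ := Nat.minFac_dvd n
    have hm0 : m ≠ 0 := by rintro rfl; simp at hm; exact hn hm
    have e : J(x | n) = J(x | n.minFac * m) := by rw [← hm]
    rw [e, jacobiSym.mul_right' _ hp.ne_zero hm0, h _ hp (Nat.minFac_dvd n), one_mul]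
    refine ih m ?_ hm0 fun p hp' hd => h p hp' (hm ▸ hd.mul_left _)
    have := hp.two_le
    have hm1 : 0 < m := Nat.pos_of_ne_zero hm0
    nlinarith

lemma J_of_square {p : ℕ} [hp : Fact p.Prime] {x : ℤ} (h : IsSquare (x : ZMod p))
    (h0 : ¬ (p : ℤ) ∣ x) : J(x | p) = 1 := by
  rw [← jacobiSym.legendreSym.to_jacobiSym, legendreSym.eq_one_iff]
  · exact h
  · rwa [Ne, ZMod.intCast_zmod_eq_zero_iff_dvd]

lemma prime_facts {p : ℕ} (hp : p.Prime) {a b c : ℤ} (ha : Squarefree a) (hab : IsCoprime a b)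
    (hac : IsCoprime a c) (hd : (p : ℤ) ∣ a) :
    ¬ (p : ℤ) ^ 2 ∣ a ∧ ¬ (p : ℤ) ∣ b ∧ ¬ (p : ℤ) ∣ c ∧ ¬ (p : ℤ) ∣ -(b * c) := by
  have hpp := Nat.prime_iff_prime_int.1 hp
  have h1 : ¬ (p : ℤ) ^ 2 ∣ a := fun h => hpp.not_isUnit (ha _ (by rwa [← pow_two]))
  have h2 : ¬ (p : ℤ) ∣ b := fun h => hpp.not_isUnit (hab.isUnit_of_dvd' hd h)
  have h3 : ¬ (p : ℤ) ∣ c := fun h => hpp.not_isUnit (hac.isUnit_of_dvd' hd h)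
  refine ⟨h1, h2, h3, ?_⟩
  rw [dvd_neg, hpp.dvd_mul]
  tauto

lemma jac_local {q : ℕ} {a b c : ℤ} (ha : Squarefree a) (hab : IsCoprime a b) (hac : IsCoprime a c)
    (h : ∀ (p : ℕ) (_ : Fact p.Prime), p ≠ q → Tern ℚ_[p] a b c) {n : ℕ} (hn : (n : ℤ) ∣ a)
    (hqn : ¬ q ∣ n) : J(-(b * c) | n) = 1 := by
  have hn0 : n ≠ 0 := by
    rintro rfl
    simp at hn
    exact ha.ne_zero hn
  refine jac_one hn0 fun p hp hd => ?_
  have : Fact p.Prime := ⟨hp⟩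
  have hpa : (p : ℤ) ∣ a := (Int.natCast_dvd_natCast.2 hd).trans hn
  obtain ⟨f1, f2, f3, f4⟩ := prime_facts hp ha hab hac hpa
  have hpq : p ≠ q := by rintro rfl; exact hqn hd
  exact J_of_square (local_cond hpa f1 f2 f3 (h p inferInstance hpq)) f4

lemma od_dvd_int (a : ℤ) : (od a : ℤ) ∣ a := Int.natCast_dvd.2 (od_dvd a)

/-- Reciprocity: the local condition at `q` follows from those at the other places. -/
lemma recip {q : ℕ} [hq : Fact q.Prime] (hq2 : q ≠ 2) {a b c : ℤ} (ha : Squarefree a)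
    (hb : Squarefree b) (hc : Squarefree c)
    (hab : IsCoprime a b) (hac : IsCoprime a c) (hbc : IsCoprime b c)
    (hR : Tern ℝ a b c) (h : ∀ (p : ℕ) (_ : Fact p.Prime), p ≠ q → Tern ℚ_[p] a b c)
    (hqc : (q : ℤ) ∣ c) : IsSquare ((-(a * b) : ℤ) : ZMod q) := by
  have hP := recip_prod ha hb hc hab hac hbc hR (h 2 inferInstance hq2.symm)
  have hqq := Nat.prime_iff_prime_int.1 hq.1
  obtain ⟨f1, f2, f3, f4⟩ := prime_facts hq.1 hc hac.symm hbc.symm hqc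
  have h1 : J(-(b * c) | od a) = 1 := by
    refine jac_local ha hab hac h (od_dvd_int a) fun hd => f2 ?_
    exact (Int.natCast_dvd_natCast.2 hd).trans (od_dvd_int a)
  have h2 : J(-(a * c) | od b) = 1 := by
    refine jac_local hb hab.symm hbc (fun p hp hpq => (h p hp hpq).swap) (od_dvd_int b) fun hd => f3 ?_
    exact (Int.natCast_dvd_natCast.2 hd).trans (od_dvd_int b)
  rw [h1, h2, one_mul, one_mul] at hP
  have hqo : q ∣ od c := by
    have h3 : q ∣ c.natAbs := Int.natCast_dvd.1 hqc
    rw [od]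
    split_ifs with h2c
    · have : c.natAbs = 2 * (c.natAbs / 2) := by omega
      rw [this] at h3
      exact ((hq.1.dvd_mul).1 h3).resolve_left fun h => hq2 ((Nat.prime_dvd_prime_iff_eq hq.1 Nat.prime_two).1 h)
    · exact h3
  obtain ⟨m, hm⟩ := hqo
  have hm0 : m ≠ 0 := by
    rintro rfl
    have := od_dvd c
    rw [hm] at this
    simp at this
    exact hc.ne_zero this
  have h3 : J(-(a * b) | m) = 1 := by
    refine jac_local hc hac.symm hbc.symm (fun p hp hpq => (h p hp hpq).rot.rot) ?_ fun hd => f1 ?_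
    · exact (Int.natCast_dvd_natCast.2 (hm ▸ Dvd.intro_left q rfl)).trans (od_dvd_int c)
    · refine dvd_trans ?_ (od_dvd_int c)
      rw [hm, pow_two]
      push_cast
      exact mul_dvd_mul_left _ (Int.natCast_dvd_natCast.2 hd)
  rw [hm, jacobiSym.mul_right' _ hq.1.ne_zero hm0, h3, mul_one] at hP
  exact ZMod.isSquare_of_jacobiSym_eq_one hP


lemma int_sqfree (n : ℤ) (hn : n ≠ 0) : ∃ d s : ℤ, Squarefree d ∧ s ≠ 0 ∧ n = d * s ^ 2 := by
  obtain ⟨a, b, h, ha⟩ := Nat.sq_mul_squarefree n.natAbs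
  have hb : b ≠ 0 := by
    rintro rfl
    simp at h
    omega
  have h' : (b : ℤ) ^ 2 * a = n.natAbs := by exact_mod_cast h
  rcases Int.natAbs_eq n with hn' | hn'
  · exact ⟨a, b, Int.squarefree_natCast.2 ha, by exact_mod_cast hb, by rw [hn', ← h']; ring⟩
  · refine ⟨-a, b, ?_, by exact_mod_cast hb, by rw [hn', ← h']; ring⟩
    rw [← Int.squarefree_natAbs]
    simpa using ha

lemma rat_sqfree (r : ℚ) (hr : r ≠ 0) : ∃ (d : ℤ) (s : ℚ), Squarefree d ∧ s ≠ 0 ∧ r = d * s ^ 2 := by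
  have hd : (r.den : ℤ) ≠ 0 := by exact_mod_cast r.den_ne_zero
  obtain ⟨d, s, h1, h2, h3⟩ := int_sqfree (r.num * r.den) (mul_ne_zero (Rat.num_ne_zero.2 hr) hd)
  have hd' : (r.den : ℚ) ≠ 0 := by exact_mod_cast r.den_ne_zero
  refine ⟨d, s / r.den, h1, div_ne_zero (by exact_mod_cast h2) hd', ?_⟩
  have h4 : (r.num : ℚ) * r.den = d * s ^ 2 := by exact_mod_cast h3
  have h5 : r * r.den = r.num := Rat.mul_den_eq_num r
  field_simp
  rw [← h4, ← h5]; ring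

lemma square_mod {a : ℤ} {n : ℕ} (hn : Squarefree n)
    (h : ∀ p : ℕ, p.Prime → p ∣ n → IsSquare (a : ZMod p)) : ∃ t : ℤ, (n : ℤ) ∣ t ^ 2 - a := by
  induction n using Nat.strong_induction_on with
  | _ n ih =>
  by_cases h1 : n = 1
  · subst h1; exact ⟨0, by simp⟩
  · have hp := Nat.minFac_prime h1
    have hpd := Nat.minFac_dvd n
    set p := n.minFac
    obtain ⟨m, hm⟩ := hpd
    have hm0 : m ≠ 0 := by rintro rfl; exact hn.ne_zero (by simpa using hm)
    have hsq : Squarefree (p * m) := hm ▸ hn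
    have hcop := Nat.coprime_of_squarefree_mul hsq
    have hm1 : 0 < m := Nat.pos_of_ne_zero hm0
    obtain ⟨t, ht⟩ := ih m (by have := hp.two_le; nlinarith) (hsq.squarefree_of_dvd (Dvd.intro_left _ rfl))
      fun r hr hd => h r hr (hm ▸ hd.mul_left _)
    obtain ⟨w, hw⟩ := h p hp (Nat.minFac_dvd n)
    obtain ⟨s, rfl⟩ := ZMod.intCast_surjective w
    have hs : (p : ℤ) ∣ s ^ 2 - a := by
      rw [← ZMod.intCast_zmod_eq_zero_iff_dvd]
      push_cast
      rw [hw]; ring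
    obtain ⟨u, v, huv⟩ := (Nat.isCoprime_iff_coprime.2 hcop)
    refine ⟨s * (v * m) + t * (u * p), ?_⟩
    rw [hm]
    push_cast
    apply IsCoprime.mul_dvd (Nat.isCoprime_iff_coprime.2 hcop)
    · have : (s * (v * m) + t * (u * p)) ^ 2 - a = (s ^ 2 - a) +
        p * (((t - s) * u) * (s * (v * m) + t * (u * p) + s)) := by
        have e : v * (m : ℤ) = 1 - u * p := by linarith
        rw [e]; ring
      rw [this]
      exact dvd_add hs (Dvd.intro _ rfl)
    · have : (s * (v * m) + t * (u * p)) ^ 2 - a = (t ^ 2 - a) +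
        m * (((s - t) * v) * (s * (v * m) + t * (u * p) + t)) := by
        have e : u * (p : ℤ) = 1 - v * m := by linarith
        rw [e]; ring
      rw [this]
      exact dvd_add ht (Dvd.intro _ rfl)

/-- local isotropy away from `q` -/
def LocT (q : ℕ) (a b c : ℚ) : Prop :=
  Tern ℝ a b c ∧ ∀ (p : ℕ) (_ : Fact p.Prime), p ≠ q → Tern ℚ_[p] a b c

lemma LocT.map {q : ℕ} {a b c a' b' c' : ℚ}
    (f : ∀ (K : Type) [Field K] [CharZero K], Tern K a b c → Tern K a' b' c')
    (h : LocT q a b c) : LocT q a' b' c' :=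
  ⟨f ℝ h.1, fun p hp hpq => f ℚ_[p] (h.2 p hp hpq)⟩

lemma sq_mod_prime {q : ℕ} (hq : q.Prime) (hq2 : q ≠ 2) {a b : ℤ} (ha : Squarefree a)
    (hb : Squarefree b) (h : LocT q 1 (-a) (-b)) {p : ℕ} (hp : p.Prime) (hpb : (p : ℤ) ∣ b) :
    IsSquare (a : ZMod p) := by
  have : Fact p.Prime := ⟨hp⟩
  have hpp := Nat.prime_iff_prime_int.1 hp
  by_cases hpa : (p : ℤ) ∣ a
  · rw [(ZMod.intCast_zmod_eq_zero_iff_dvd a p).2 hpa]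
    exact ⟨0, by simp⟩
  by_cases hpq : p = q
  · subst hpq
    set g : ℤ := (Int.gcd a b : ℤ) with hg
    obtain ⟨a', ha'⟩ : g ∣ a := Int.gcd_dvd_left ..
    obtain ⟨b', hb'⟩ : g ∣ b := Int.gcd_dvd_right ..
    have hg0 : g ≠ 0 := by
      intro h0
      rw [h0] at ha'
      exact ha.ne_zero (by simpa using ha')
    have hcop : IsCoprime a' b' := by
      have h1 : Int.gcd (g * a') (g * b') = g.natAbs * Int.gcd a' b' := Int.gcd_mul_left ..
      rw [← ha', ← hb'] at h1
      rw [Int.isCoprime_iff_gcd_eq_one]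
      have h2 : g.natAbs = Int.gcd a b := by rw [hg]; simp
      rw [h2] at h1
      have h3 : 0 < Int.gcd a b := by omega
      exact (Nat.eq_of_mul_eq_mul_left h3 (by omega)).symm
    have hga : IsCoprime g a' := by
      have := Int.isCoprime_iff_gcd_eq_one (m := g) (n := a')
      exact (squarefree_mul_iff.1 (ha' ▸ ha)).1.isCoprime
    have hgb : IsCoprime g b' := (squarefree_mul_iff.1 (hb' ▸ hb)).1.isCoprime
    have sg' : Squarefree g := ha.squarefree_of_dvd (ha' ▸ Dvd.intro _ rfl)
    have sa' : Squarefree (-a') := by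
      rw [← Int.squarefree_natAbs, Int.natAbs_neg, Int.squarefree_natAbs]
      exact ha.squarefree_of_dvd (ha' ▸ Dvd.intro_left _ rfl)
    have sb' : Squarefree (-b') := by
      rw [← Int.squarefree_natAbs, Int.natAbs_neg, Int.squarefree_natAbs]
      exact hb.squarefree_of_dvd (hb' ▸ Dvd.intro_left _ rfl)
    have hL : LocT p (g : ℤ) ((-a' : ℤ)) ((-b' : ℤ)) := by
      refine h.map fun K _ _ hT => ?_
      have hgK : (g : K) ≠ 0 := by exact_mod_cast hg0
      have := (hT.smul (g : K)).sq (r := 1) (s := (g : K)⁻¹) (t := (g : K)⁻¹) one_ne_zero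
        (inv_ne_zero hgK) (inv_ne_zero hgK)
      convert this using 1
      · simp
      · rw [ha']; push_cast; field_simp
      · rw [hb']; push_cast; field_simp
    have hpg : ¬ (p : ℤ) ∣ g := fun hd => hpa (ha' ▸ hd.mul_right _)
    have hpb' : (p : ℤ) ∣ -b' := by
      rw [dvd_neg]
      rw [hb'] at hpb
      exact (hpp.dvd_mul.1 hpb).resolve_left hpg
    have := recip hq2 sg' sa' sb' hga.neg_right hgb.neg_right hcop.neg_neg
      (by simpa using hL.1) (fun p' hp' hne => by simpa using hL.2 p' hp' hne) hpb'
    have e : -(g * -a') = a := by rw [ha']; ring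
    rwa [e] at this
  · have hT := h.2 p this hpq
    have hT' : Tern ℚ_[p] ((-b : ℤ) : ℚ_[p]) ((1 : ℤ) : ℚ_[p]) ((-a : ℤ) : ℚ_[p]) := by
      simpa using hT.rot.rot
    have := local_cond (p := p) (dvd_neg.2 hpb)
      (fun hd => hpp.not_isUnit (hb _ (by rw [← pow_two]; exact dvd_neg.1 hd)))
      (fun hd => hpp.not_isUnit (isUnit_of_dvd_one hd)) (fun hd => hpa (dvd_neg.1 hd)) hT'
    simpa using this

lemma small_root {a : ℤ} {b : ℤ} (hb : b ≠ 0) {t : ℤ} (ht : b ∣ t ^ 2 - a) :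
    ∃ s : ℤ, b ∣ s ^ 2 - a ∧ 4 * s ^ 2 ≤ b ^ 2 := by
  have hr0 := Int.emod_nonneg t hb
  have hr1 := Int.emod_lt_abs t hb
  have hmod : b ∣ t - t % b := Int.dvd_self_sub_emod
  have hr : b ∣ (t % b) ^ 2 - a := by
    have : (t % b) ^ 2 - a = (t ^ 2 - a) - (t - t % b) * (t + t % b) := by ring
    rw [this]
    exact dvd_sub ht (hmod.mul_right _)
  set r := t % b
  by_cases h : 2 * r ≤ |b|
  · refine ⟨r, hr, ?_⟩
    rw [← sq_abs b]; nlinarith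
  · refine ⟨r - |b|, ?_, ?_⟩
    · have : (r - |b|) ^ 2 - a = (r ^ 2 - a) - |b| * (2 * r - |b|) := by ring
      rw [this]
      exact dvd_sub hr (((dvd_abs b b).2 dvd_rfl).mul_right _)
    · rw [← sq_abs b]; nlinarith

lemma descent {q : ℕ} (hq : q.Prime) (hq2 : q ≠ 2) (N : ℕ) : ∀ {a b : ℤ} (_ : Squarefree a)
    (_ : Squarefree b) (_ : LocT q 1 (-a) (-b)) (_ : a.natAbs + b.natAbs ≤ N),
    Tern ℚ 1 (-a) (-b) := by
  induction N using Nat.strong_induction_on with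
  | _ N ih =>
  intro a b ha hb h hN
  wlog hab : a.natAbs ≤ b.natAbs generalizing a b with H
  · exact (H hb ha (h.map fun K _ _ hT => hT.swap.rot) (by omega) (by omega)).swap.rot
  have ha0 := ha.ne_zero
  have hb0 := hb.ne_zero
  by_cases hb1 : b.natAbs = 1
  · by_cases h1 : a = 1
    · exact ⟨1, 1, 0, by simp, by simp [h1]⟩
    by_cases h2 : b = 1
    · exact ⟨1, 0, 1, by simp, by simp [h2]⟩
    have h1 : a = -1 := by omega
    have h2 : b = -1 := by omega
    subst h1 h2
    obtain ⟨x, y, z, h0, h⟩ := h.1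
    simp at h
    exfalso
    rcases h0 with h0 | h0 | h0 <;> nlinarith [sq_nonneg x, sq_nonneg y, sq_nonneg z, sq_pos_of_ne_zero h0]
  · have hbn : Squarefree b.natAbs := Int.squarefree_natAbs.2 hb
    obtain ⟨t, ht⟩ := square_mod (a := a) hbn fun p hp hd =>
      sq_mod_prime hq hq2 ha hb h hp (Int.natCast_dvd.2 hd)
    rw [Int.natAbs_dvd] at ht
    obtain ⟨s, ⟨b', hs⟩, hs2⟩ := small_root hb0 ht
    by_cases hb' : b' = 0
    · refine ⟨s, 1, 0, by simp, ?_⟩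
      rw [hb'] at hs
      have : ((s : ℚ)) ^ 2 - a = 0 := by
        have := congrArg (Int.cast : ℤ → ℚ) hs
        simpa using this
      linear_combination this
    obtain ⟨d, r, hd, hr, hdr⟩ := int_sqfree b' hb'
    have e (K : Type) [Field K] [CharZero K] : (b : K) * b' = (s : K) ^ 2 - a := by
      exact_mod_cast hs.symm
    have hloc : LocT q 1 (-a) (-d) := by
      refine h.map fun K _ _ hT => ?_
      have hbK : (b : K) ≠ 0 := by exact_mod_cast hb0
      have hbK' : (b' : K) ≠ 0 := by exact_mod_cast hb'
      have hrK : (r : K) ≠ 0 := by exact_mod_cast hr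
      have hT' : Tern K 1 (-(a : K)) (-(b : K)) := by simpa using hT
      have := (hT'.norm hbK hbK' (e K)).sq3 (s := (r : K)⁻¹) (inv_ne_zero hrK)
      convert this using 1
      · simp
      · simp
      · rw [hdr]; push_cast; field_simp
    have hd0 := hd.ne_zero
    have hlt : d.natAbs < b.natAbs := by
      zify
      have h1 : |d| ≤ |b'| := by
        rw [hdr, abs_mul]
        have : 1 ≤ |r ^ 2| := Int.one_le_abs (pow_ne_zero _ hr)
        nlinarith [abs_nonneg d]
      have h2 : |b| * |b'| ≤ s ^ 2 + |a| := by
        rw [← abs_mul, ← hs]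
        calc |s ^ 2 - a| ≤ |s ^ 2| + |a| := abs_sub _ _
          _ = _ := by rw [abs_of_nonneg (sq_nonneg s)]
      have h3 : |a| ≤ |b| := by zify at hab; exact hab
      have h4 : 2 ≤ |b| := by
        have : 2 ≤ b.natAbs := by omega
        zify at this; exact this
      rw [← sq_abs b] at hs2
      have h5 : |b| * (4 * |b'|) ≤ |b| * (|b| + 4) := by nlinarith
      have h6 := le_of_mul_le_mul_left h5 (by linarith)
      linarith
    have hQ := ih (a.natAbs + d.natAbs) (by omega) ha hd hloc le_rfl
    have hrQ : (r : ℚ) ≠ 0 := by exact_mod_cast hr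
    have hQ' : Tern ℚ 1 (-(a : ℚ)) (-(b' : ℚ)) := by
      have := hQ.sq3 hrQ
      convert this using 1
      rw [hdr]; push_cast; ring
    exact hQ'.norm (by exact_mod_cast hb') (by exact_mod_cast hb0) (by rw [← e ℚ]; ring)

lemma Tern.swap23 {K : Type*} [Field K] {a b c : K} (h : Tern K a b c) : Tern K a c b := h.swap.rot

theorem tern_hasse {q : ℕ} (hq : q.Prime) (hq2 : q ≠ 2) {a b c : ℚ} (ha : a ≠ 0) (hb : b ≠ 0)
    (hc : c ≠ 0) (h : LocT q a b c) : Tern ℚ a b c := by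
  obtain ⟨A, r, hA, hr, eA⟩ := rat_sqfree (-b / a) (div_ne_zero (neg_ne_zero.2 hb) ha)
  obtain ⟨B, s, hB, hs, eB⟩ := rat_sqfree (-c / a) (div_ne_zero (neg_ne_zero.2 hc) ha)
  have hbb : b = -(a * (A * r ^ 2)) := by rw [← eA]; field_simp
  have hcc : c = -(a * (B * s ^ 2)) := by rw [← eB]; field_simp
  have hL : LocT q 1 (-A) (-B) := by
    refine h.map fun K _ _ hT => ?_
    have haK : (a : K) ≠ 0 := by exact_mod_cast ha
    have hrK : (r : K) ≠ 0 := by exact_mod_cast hr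
    have hsK : (s : K) ≠ 0 := by exact_mod_cast hs
    have := (hT.smul (a : K)⁻¹).sq (r := 1) (s := (r : K)⁻¹) (t := (s : K)⁻¹) one_ne_zero
      (inv_ne_zero hrK) (inv_ne_zero hsK)
    convert this using 1
    · simp; field_simp
    · rw [hbb]; push_cast; field_simp
    · rw [hcc]; push_cast; field_simp
  have hQ := descent hq hq2 _ hA hB hL le_rfl
  have := (hQ.smul a).sq one_ne_zero hr hs
  convert this using 1
  · ring
  · rw [hbb]; ring
  · rw [hcc]; ring


/-- isotropy of a diagonal form -/
def DIso (K : Type*) [Field K] {n : ℕ} (a : Fin n → K) : Prop :=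
  ∃ v : Fin n → K, v ≠ 0 ∧ ∑ i, a i * v i ^ 2 = 0

def DRep (K : Type*) [Field K] {n : ℕ} (a : Fin n → K) (t : K) : Prop :=
  ∃ v : Fin n → K, ∑ i, a i * v i ^ 2 = t

section gen
variable {K : Type*} [Field K] [CharZero K]

lemma DIso.universal {n : ℕ} {a : Fin n → K} (ha : ∀ i, a i ≠ 0) (h : DIso K a) (t : K) :
    DRep K a t := by
  obtain ⟨v, hv, h⟩ := h
  obtain ⟨i, hi⟩ : ∃ i, v i ≠ 0 := by
    by_contra! hc
    exact hv (funext hc)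
  set s := (t - a i) / (2 * a i * v i) with hs
  refine ⟨fun j => s * v j + if j = i then 1 else 0, ?_⟩
  have e : ∀ j, a j * (s * v j + if j = i then 1 else 0) ^ 2 =
      s ^ 2 * (a j * v j ^ 2) + if j = i then (2 * s * a j * v j + a j) else 0 := by
    intro j
    split_ifs <;> ring
  simp_rw [e]
  rw [Finset.sum_add_distrib, ← Finset.mul_sum, h]
  simp
  have := ha i
  rw [hs]
  field_simp
  ring

lemma tern_rep {a b t : K} (ha : a ≠ 0) (hb : b ≠ 0) (h : Tern K a b (-t)) :
    ∃ x y, a * x ^ 2 + b * y ^ 2 = t := by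
  obtain ⟨x, y, z, h0, h⟩ := h
  by_cases hz : z = 0
  · have : DIso K ![a, b] := by
      refine ⟨![x, y], ?_, ?_⟩
      · intro hc
        have h1 := congrFun hc 0
        have h2 := congrFun hc 1
        simp at h1 h2
        simp_all
      · simp [Fin.sum_univ_two]
        simpa [hz] using h
    obtain ⟨v, hv⟩ := this.universal (by intro i; fin_cases i <;> simpa) t
    exact ⟨v 0, v 1, by simpa [Fin.sum_univ_two] using hv⟩
  · refine ⟨x / z, y / z, ?_⟩
    field_simp
    linear_combination h

lemma split_two {m : ℕ} {a : Fin (m + 2) → K} (hm : 0 < m) (ha : ∀ i, a i ≠ 0) (h : DIso K a) :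
    ∃ (x y : K) (w : Fin m → K), a 0 * x ^ 2 + a 1 * y ^ 2 ≠ 0 ∧
      ∑ i : Fin m, a i.succ.succ * w i ^ 2 = -(a 0 * x ^ 2 + a 1 * y ^ 2) := by
  obtain ⟨v, hv, h⟩ := h
  rw [Fin.sum_univ_succ, Fin.sum_univ_succ] at h
  simp only [Fin.succ_zero_eq_one] at h
  by_cases h0 : a 0 * v 0 ^ 2 + a 1 * v 1 ^ 2 = 0
  · by_cases hw : (fun i : Fin m => v i.succ.succ) = 0
    · let i0 : Fin m := ⟨0, hm⟩
      have hT : Tern K (a 0) (a 1) (-(-(a i0.succ.succ))) := by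
        refine ⟨v 0, v 1, 0, ?_, by linear_combination h0⟩
        by_contra! hc
        apply hv
        funext i
        refine Fin.cases hc.1 (fun i => ?_) i
        refine Fin.cases hc.2.1 (fun i => ?_) i
        exact congrFun hw i
      obtain ⟨x, y, hxy⟩ := tern_rep (ha 0) (ha 1) hT
      refine ⟨x, y, Pi.single i0 1, ?_, ?_⟩
      · rw [hxy]; simpa using ha _
      · rw [hxy, Finset.sum_eq_single i0]
        · simp
        · intro j _ hj; simp [hj]
        · simp
    · have : DIso K (fun i : Fin m => a i.succ.succ) := ⟨_, hw, by linear_combination h - h0⟩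
      obtain ⟨w, hw⟩ := this.universal (fun i => ha _) (-(a 0))
      exact ⟨1, 0, w, by simpa using ha 0, by rw [hw]; simp⟩
  · exact ⟨v 0, v 1, fun i => v i.succ.succ, h0, by linear_combination h⟩

end gen

section approx

lemma exists_modulus (S : Finset ℕ) (hS : ∀ p ∈ S, p.Prime) {ε : ℝ} (hε : 0 < ε) :
    ∃ M : ℕ, M ≠ 0 ∧ (∀ (p : ℕ) (_ : Fact p.Prime), p ∈ S → p ∣ M ∧ ‖(M : ℚ_[p])‖ < ε) := by
  obtain ⟨k, hk⟩ := exists_pow_lt_of_lt_one hε (show (1 / 2 : ℝ) < 1 by norm_num)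
  refine ⟨(∏ p ∈ S, p) ^ (k + 1), pow_ne_zero _ (Finset.prod_ne_zero_iff.2 fun p hp => (hS p hp).ne_zero), ?_⟩
  intro p hp hpS
  have hd : p ∣ ∏ p ∈ S, p := Finset.dvd_prod_of_mem (fun p => p) hpS
  refine ⟨hd.trans (dvd_pow_self _ (by omega)), ?_⟩
  obtain ⟨m, hm⟩ := hd
  rw [hm]
  push_cast
  rw [norm_pow, norm_mul, Padic.norm_p]
  have hm1 : ‖(m : ℚ_[p])‖ ≤ 1 := by simpa using Padic.norm_int_le_one (p := p) m
  have hp2 : (p : ℝ)⁻¹ ≤ 1 / 2 := by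
    rw [one_div]
    apply inv_anti₀ (by norm_num)
    exact_mod_cast hp.1.two_le
  have h1 : (p : ℝ)⁻¹ * ‖(m : ℚ_[p])‖ ≤ 1 / 2 := by
    have : (0 : ℝ) ≤ (p : ℝ)⁻¹ := by positivity
    nlinarith
  calc _ ≤ (1 / 2 : ℝ) ^ (k + 1) := pow_le_pow_left₀ (by positivity) h1 _
    _ ≤ (1 / 2 : ℝ) ^ k := pow_le_pow_of_le_one (by norm_num) (by norm_num) (by omega)
    _ < ε := hk

lemma padic_approx_frac {p : ℕ} [hp : Fact p.Prime] (y : ℚ_[p]) {ε : ℝ} (hε : 0 < ε) :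
    ∃ (n k : ℕ), ‖((n / p ^ k : ℚ) : ℚ_[p]) - y‖ < ε := by
  have hp0 : (p : ℚ_[p]) ≠ 0 := by exact_mod_cast hp.1.ne_zero
  obtain ⟨k, hk⟩ : ∃ k : ℕ, ‖y * p ^ k‖ ≤ 1 := by
    obtain ⟨k, hk⟩ := pow_unbounded_of_one_lt ‖y‖ (show (1 : ℝ) < p by exact_mod_cast hp.1.one_lt)
    refine ⟨k, ?_⟩
    rw [norm_mul, norm_pow, Padic.norm_p, inv_pow]
    have : (0 : ℝ) < p ^ k := pow_pos (by exact_mod_cast hp.1.pos) _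
    rw [← div_eq_mul_inv, div_le_one this]
    exact hk.le
  have hpk : 0 < ‖(p : ℚ_[p]) ^ k‖ := norm_pos_iff.2 (pow_ne_zero _ hp0)
  obtain ⟨Y, hY⟩ : ∃ Y : ℤ_[p], (Y : ℚ_[p]) = y * p ^ k := ⟨⟨_, hk⟩, rfl⟩
  obtain ⟨n, hn⟩ := PadicInt.denseRange_natCast.exists_dist_lt Y (mul_pos hε hpk)
  refine ⟨n, k, ?_⟩
  rw [dist_eq_norm, norm_sub_rev, PadicInt.norm_def] at hn
  push_cast at hn
  rw [hY] at hn
  push_cast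
  have : (n : ℚ_[p]) / p ^ k - y = (n - y * p ^ k) / p ^ k := by field_simp
  rw [this, norm_div, div_lt_iff₀ hpk]
  exact hn

lemma norm_natCast_one {p m : ℕ} [hp : Fact p.Prime] (h : ¬ p ∣ m) : ‖(m : ℚ_[p])‖ = 1 := by
  rw [Padic.norm_natCast_eq_one_iff]
  exact (Nat.Prime.coprime_iff_not_dvd hp.1).2 h

lemma norm_natCast_le {p m : ℕ} [hp : Fact p.Prime] : ‖(m : ℚ_[p])‖ ≤ 1 := by
  simpa using Padic.norm_int_le_one (p := p) m

lemma weak_approx_fin (S : Finset ℕ) (hS : ∀ p ∈ S, p.Prime)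
    (x : ∀ (p : ℕ) (_ : Fact p.Prime), ℚ_[p]) {ε : ℝ} (hε : 0 < ε) :
    ∃ r : ℚ, ∀ (p : ℕ) (hp : Fact p.Prime), p ∈ S → ‖(r : ℚ_[p]) - x p hp‖ < ε := by
  induction S using Finset.induction_on with
  | empty => exact ⟨0, by simp⟩
  | insert p0 S hp0 ih =>
    have hS' : ∀ p ∈ S, p.Prime := fun p hp => hS p (Finset.mem_insert_of_mem hp)
    obtain ⟨r, hr⟩ := ih hS'
    obtain ⟨M, hM0, hM⟩ := exists_modulus S hS' hε
    have hpp : p0.Prime := hS p0 (Finset.mem_insert_self _ _)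
    have : Fact p0.Prime := ⟨hpp⟩
    have hM0' : (M : ℚ_[p0]) ≠ 0 := by exact_mod_cast hM0
    obtain ⟨n, k, hnk⟩ := padic_approx_frac (p := p0)
      ((x p0 this - (r : ℚ_[p0])) / (M : ℚ_[p0])) hε
    refine ⟨r + M * (n / p0 ^ k), ?_⟩
    intro p hp hpS
    rcases Finset.mem_insert.1 hpS with rfl | hpS'
    · have e : ((r + M * (n / p ^ k) : ℚ) : ℚ_[p]) - x p hp =
          M * (((n / p ^ k : ℚ) : ℚ_[p]) - (x p hp - r) / M) := by
        push_cast; field_simp; ring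
      rw [e, norm_mul]
      have := norm_natCast_le (p := p) (m := M)
      have h2 := norm_nonneg (((n / p ^ k : ℚ) : ℚ_[p]) - (x p hp - r) / M)
      nlinarith
    · have hne : p ≠ p0 := by rintro rfl; exact hp0 hpS'
      have h1 : ‖(p0 : ℚ_[p])‖ = 1 := norm_natCast_one
        fun hd => hne ((Nat.prime_dvd_prime_iff_eq hp.1 hpp).1 hd)
      have e : ((r + M * (n / p0 ^ k) : ℚ) : ℚ_[p]) - x p hp = (r - x p hp) + M * (n / p0 ^ k) := by
        push_cast; ring
      rw [e]
      refine (Padic.nonarchimedean _ _).trans_lt (max_lt (hr p hp hpS') ?_)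
      rw [norm_mul, norm_div, norm_pow, h1, one_pow, div_one]
      have := (hM p hp hpS').2
      have h3 := norm_natCast_le (p := p) (m := n)
      nlinarith [norm_nonneg (M : ℚ_[p]), norm_nonneg (n : ℚ_[p])]

lemma weak_approx (S : Finset ℕ) (hS : ∀ p ∈ S, p.Prime) (xr : ℝ)
    (x : ∀ (p : ℕ) (_ : Fact p.Prime), ℚ_[p]) {ε : ℝ} (hε : 0 < ε) :
    ∃ r : ℚ, |(r : ℝ) - xr| < ε ∧
      ∀ (p : ℕ) (hp : Fact p.Prime), p ∈ S → ‖(r : ℚ_[p]) - x p hp‖ < ε := by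
  obtain ⟨r, hr⟩ := weak_approx_fin S hS x hε
  obtain ⟨M, hM0, hM⟩ := exists_modulus S hS hε
  obtain ⟨h, hh⟩ := exists_nat_gt (1 / ε)
  have hM' : (0 : ℝ) < M := by exact_mod_cast Nat.pos_of_ne_zero hM0
  have hh0 : (0 : ℝ) < h := lt_trans (by positivity) hh
  set w : ℕ := M * h + 1 with hw
  have hw0 : (0 : ℝ) < w := by rw [hw]; positivity
  set n : ℤ := ⌊(xr - r) / M * w⌋ with hn
  refine ⟨r + M * (n / w), ?_, ?_⟩
  · have h1 := Int.floor_le ((xr - r) / M * w)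
    have h2 := Int.lt_floor_add_one ((xr - r) / M * w)
    rw [← hn] at h1 h2
    have e : ((r + M * (n / w) : ℚ) : ℝ) - xr = (M / w) * (n - (xr - r) / M * w) := by
      push_cast; field_simp; ring
    rw [e, abs_mul, abs_of_pos (div_pos hM' hw0)]
    have h3 : |(n : ℝ) - (xr - r) / M * w| ≤ 1 := by
      rw [abs_le]; constructor <;> linarith
    have h4 : (M : ℝ) / w < ε := by
      rw [div_lt_iff₀ hw0, hw]
      push_cast
      have : 1 < ε * h := by
        rw [div_lt_iff₀ hε] at hh; linarith
      nlinarith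
    have : 0 < (M : ℝ) / w := div_pos hM' hw0
    nlinarith [abs_nonneg ((n : ℝ) - (xr - r) / M * w)]
  · intro p hp hpS
    obtain ⟨hd, hlt⟩ := hM p hp hpS
    have h1 : ‖(w : ℚ_[p])‖ = 1 := norm_natCast_one fun hd' => by
      have : p ∣ 1 := (Nat.dvd_add_right (hd.mul_right h)).1 (hw ▸ hd')
      exact hp.1.one_lt.ne' (Nat.dvd_one.1 this)
    have e : ((r + M * (n / w) : ℚ) : ℚ_[p]) - x p hp = (r - x p hp) + M * (n / w) := by
      push_cast; ring
    rw [e]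
    refine (Padic.nonarchimedean _ _).trans_lt (max_lt (hr p hp hpS) ?_)
    rw [norm_mul, norm_div, h1, div_one]
    have h3 := Padic.norm_int_le_one (p := p) n
    nlinarith [norm_nonneg (M : ℚ_[p]), norm_nonneg (n : ℚ_[p])]

lemma sq_nhds {K : Type*} [NormedField K] {η : ℝ} (hη : 0 < η)
    (hsq : ∀ u : K, ‖u - 1‖ < η → ∃ s, s ≠ 0 ∧ u = s ^ 2) (a b x y : K)
    (h : a * x ^ 2 + b * y ^ 2 ≠ 0) :
    ∃ δ > 0, ∀ X Y : K, ‖X - x‖ < δ → ‖Y - y‖ < δ →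
      ∃ s, s ≠ 0 ∧ a * X ^ 2 + b * Y ^ 2 = (a * x ^ 2 + b * y ^ 2) * s ^ 2 := by
  have hc : Continuous fun z : K × K => (a * z.1 ^ 2 + b * z.2 ^ 2) / (a * x ^ 2 + b * y ^ 2) := by
    fun_prop
  obtain ⟨δ, hδ, H⟩ := Metric.continuousAt_iff.1 (hc.continuousAt (x := (x, y))) η hη
  refine ⟨δ, hδ, fun X Y hX hY => ?_⟩
  have := @H (X, Y) (by
    rw [Prod.dist_eq, max_lt_iff, dist_eq_norm, dist_eq_norm]; exact ⟨hX, hY⟩)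
  simp only [dist_eq_norm, div_self h] at this
  obtain ⟨s, hs, e⟩ := hsq _ this
  refine ⟨s, hs, ?_⟩
  rw [← e]; field_simp

lemma exists_pos_lb (S : Finset ℕ) (δ : ℕ → ℝ) (hδ : ∀ p, 0 < δ p) :
    ∃ ε > 0, ∀ p ∈ S, ε ≤ δ p := by
  induction S using Finset.induction_on with
  | empty => exact ⟨1, by simp⟩
  | insert p S hp ih =>
    obtain ⟨ε, hε, h⟩ := ih
    refine ⟨min ε (δ p), lt_min hε (hδ p), ?_⟩
    intro r hr
    rcases Finset.mem_insert.1 hr with rfl | hr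
    · exact min_le_right _ _
    · exact (min_le_left _ _).trans (h r hr)

lemma approx_sq (S : Finset ℕ) (hS : ∀ p ∈ S, p.Prime) (a b : ℚ) (xr yr : ℝ)
    (x y : ∀ (p : ℕ) (_ : Fact p.Prime), ℚ_[p]) (hr : (a : ℝ) * xr ^ 2 + b * yr ^ 2 ≠ 0)
    (hp : ∀ (p : ℕ) (hp : Fact p.Prime), (a : ℚ_[p]) * x p hp ^ 2 + b * y p hp ^ 2 ≠ 0) :
    ∃ X Y : ℚ, (∃ s : ℝ, s ≠ 0 ∧
        ((a * X ^ 2 + b * Y ^ 2 : ℚ) : ℝ) = (a * xr ^ 2 + b * yr ^ 2) * s ^ 2) ∧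
      ∀ (p : ℕ) (hp : Fact p.Prime), p ∈ S → ∃ s : ℚ_[p], s ≠ 0 ∧
        ((a * X ^ 2 + b * Y ^ 2 : ℚ) : ℚ_[p]) = (a * x p hp ^ 2 + b * y p hp ^ 2) * s ^ 2 := by
  obtain ⟨δr, hδr, Hr⟩ := sq_nhds (K := ℝ) zero_lt_one (by
    intro u hu
    rw [Real.norm_eq_abs, abs_lt] at hu
    have : 0 < u := by linarith
    exact ⟨√u, (Real.sqrt_pos.2 this).ne', (Real.sq_sqrt this.le).symm⟩) (a : ℝ) b xr yr hr
  have Hp : ∀ p : ℕ, ∃ δ > 0, ∀ (hp : Fact p.Prime), ∀ X Y : ℚ_[p], ‖X - x p hp‖ < δ →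
      ‖Y - y p hp‖ < δ → ∃ s, s ≠ 0 ∧ (a : ℚ_[p]) * X ^ 2 + b * Y ^ 2 =
        (a * x p hp ^ 2 + b * y p hp ^ 2) * s ^ 2 := by
    intro p
    by_cases hpp : p.Prime
    · have hF : Fact p.Prime := ⟨hpp⟩
      have h2 : (0 : ℝ) < ‖(2 : ℚ_[p])‖ ^ 2 := by
        have : (2 : ℚ_[p]) ≠ 0 := two_ne_zero
        positivity
      obtain ⟨δ, hδ, H⟩ := sq_nhds (K := ℚ_[p]) h2 (by
        intro u hu
        obtain ⟨s, hs⟩ := isSquare_near_one hu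
        refine ⟨s, ?_, by rw [hs]; ring⟩
        rintro rfl
        have h3 : ‖(2 : ℚ_[p])‖ ≤ 1 := by simpa using Padic.norm_int_le_one (p := p) 2
        rw [hs] at hu
        simp at hu
        nlinarith [norm_nonneg (2 : ℚ_[p])]) (a : ℚ_[p]) b (x p hF) (y p hF) (hp p hF)
      exact ⟨δ, hδ, fun _ => H⟩
    · exact ⟨1, one_pos, fun hF => absurd hF.1 hpp⟩
  choose δ hδ H using Hp
  obtain ⟨ε, hε, hle⟩ := exists_pos_lb S δ hδ
  obtain ⟨X, hX1, hX2⟩ := weak_approx S hS xr x (lt_min hε hδr)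
  obtain ⟨Y, hY1, hY2⟩ := weak_approx S hS yr y (lt_min hε hδr)
  refine ⟨X, Y, ?_, ?_⟩
  · push_cast
    exact Hr X Y (hX1.trans_le (min_le_right _ _)) (hY1.trans_le (min_le_right _ _))
  · intro p hF hpS
    push_cast
    exact H p hF X Y ((hX2 p hF hpS).trans_le ((min_le_left _ _).trans (hle p hpS)))
      ((hY2 p hF hpS).trans_le ((min_le_left _ _).trans (hle p hpS)))

end approx


def LocD {n : ℕ} (a : Fin n → ℚ) : Prop :=
  DIso ℝ (fun i => (a i : ℝ)) ∧ ∀ (p : ℕ) (_ : Fact p.Prime), DIso ℚ_[p] (fun i => (a i : ℚ_[p]))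

lemma bad_primes {n : ℕ} (a : Fin n → ℚ) (ha : ∀ i, a i ≠ 0) :
    ∃ S : Finset ℕ, (∀ p ∈ S, p.Prime) ∧ 2 ∈ S ∧
      ∀ (p : ℕ) (_ : Fact p.Prime), p ∉ S → ∀ i, ‖(a i : ℚ_[p])‖ = 1 := by
  set D : ℕ := 2 * ∏ i, ((a i).num.natAbs * (a i).den) with hD
  have hD0 : D ≠ 0 := by
    refine mul_ne_zero two_ne_zero (Finset.prod_ne_zero_iff.2 fun i _ => mul_ne_zero ?_ (a i).den_ne_zero)
    simpa using ha i
  refine ⟨D.primeFactors, fun p hp => Nat.prime_of_mem_primeFactors hp, ?_, ?_⟩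
  · rw [Nat.mem_primeFactors]
    exact ⟨Nat.prime_two, Dvd.intro _ rfl, hD0⟩
  · intro p hp hpS i
    have hpD : ¬ p ∣ D := fun h => hpS (Nat.mem_primeFactors.2 ⟨hp.1, h, hD0⟩)
    have hdv : (a i).num.natAbs * (a i).den ∣ D :=
      Dvd.dvd.mul_left (Finset.dvd_prod_of_mem (fun i => (a i).num.natAbs * (a i).den)
        (Finset.mem_univ i)) 2
    have h1 : ‖((a i).num.natAbs : ℚ_[p])‖ = 1 :=
      norm_natCast_one fun h => hpD ((h.mul_right _).trans hdv)
    have h2 : ‖((a i).den : ℚ_[p])‖ = 1 :=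
      norm_natCast_one fun h => hpD ((h.mul_left _).trans hdv)
    have h3 : ‖((a i).num : ℚ_[p])‖ = 1 := by
      rcases Int.natAbs_eq (a i).num with e | e
      · rw [e]; simpa using h1
      · rw [e]; simpa using h1
    rw [Rat.cast_def, norm_div, h2, h3, div_one]

lemma dirichlet_adjust (t0 : ℚ) (ht0 : t0 ≠ 0) (S : Finset ℕ) (hS : ∀ p ∈ S, p.Prime) (h2 : 2 ∈ S) :
    ∃ (t : ℚ) (q : ℕ), t ≠ 0 ∧ q.Prime ∧ q ∉ S ∧ (∃ σ : ℝ, σ ≠ 0 ∧ (t : ℝ) = t0 * σ ^ 2) ∧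
      (∀ (p : ℕ) (_ : Fact p.Prime), p ∈ S → ∃ σ : ℚ_[p], σ ≠ 0 ∧ (t : ℚ_[p]) = t0 * σ ^ 2) ∧
      ∀ (p : ℕ) (_ : Fact p.Prime), p ∉ S → p ≠ q → ‖(t : ℚ_[p])‖ = 1 := by
  obtain ⟨t1, r, hsf, hr, e0⟩ := rat_sqfree t0 ht0
  set P : ℕ := ∏ p ∈ S, p with hP
  have hP0 : P ≠ 0 := Finset.prod_ne_zero_iff.2 fun p hp => (hS p hp).ne_zero
  have hdvdP : ∀ p ∈ S, p ∣ P := fun p hp => Finset.dvd_prod_of_mem (fun p => p) hp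
  have hmem : ∀ p, p.Prime → p ∣ P → p ∈ S := by
    intro p hp hd
    obtain ⟨r, hr, hd⟩ := (Prime.dvd_finsetProd_iff hp.prime _).1 hd
    rwa [(Nat.prime_dvd_prime_iff_eq hp (hS r hr)).1 hd]
  have ht1 : t1 ≠ 0 := hsf.ne_zero
  have hT : Squarefree t1.natAbs := Int.squarefree_natAbs.2 hsf
  obtain ⟨N, hN⟩ : Nat.gcd t1.natAbs P ∣ t1.natAbs := Nat.gcd_dvd_left _ _
  set s := Nat.gcd t1.natAbs P with hs
  have hT0 : t1.natAbs ≠ 0 := by simpa using ht1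
  have hN0 : N ≠ 0 := by rintro rfl; simp at hN; exact ht1 hN
  have hs0 : s ≠ 0 := by intro h; rw [h] at hN; simp at hN; exact ht1 hN
  have hNS : ∀ p ∈ S, ¬ p ∣ N := by
    intro p hp hd
    have hpT : p ∣ t1.natAbs := hN ▸ hd.mul_left s
    have hps : p ∣ s := Nat.dvd_gcd hpT (hdvdP p hp)
    have : p * p ∣ t1.natAbs := hN ▸ mul_dvd_mul hps hd
    exact (hS p hp).one_lt.ne' (Nat.isUnit_iff.1 (hT p this))
  have hcop : N.Coprime (8 * P) := by
    refine Nat.coprime_of_dvd fun p hp h1 h3 => ?_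
    rcases hp.dvd_mul.1 h3 with h | h
    · have : p = 2 := by
        have : p ∣ 2 ^ 3 := by simpa using h
        exact (Nat.prime_dvd_prime_iff_eq hp Nat.prime_two).1 (hp.dvd_of_dvd_pow this)
      exact hNS p (this ▸ h2) h1
    · exact hNS p (hmem p hp h) h1
  obtain ⟨q, hqP, hq, hmod⟩ := Nat.forall_exists_prime_gt_and_modEq P
    (mul_ne_zero (by norm_num : 8 ≠ 0) hP0) hcop
  have hqS : q ∉ S := fun h => absurd (Nat.le_of_dvd (Nat.pos_of_ne_zero hP0) (hdvdP q h)) (by omega)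
  have ht1' : (t1 : ℚ) ≠ 0 := by exact_mod_cast ht1
  have hN0' : (N : ℚ) ≠ 0 := by exact_mod_cast hN0
  have hq0' : (q : ℚ) ≠ 0 := by exact_mod_cast hq.ne_zero
  refine ⟨t1 * (q / N), q, mul_ne_zero ht1' (div_ne_zero hq0' hN0'), hq, hqS, ?_, ?_, ?_⟩
  · have hpos : (0 : ℝ) < (q : ℝ) / N := by
      have := hq.pos; have := Nat.pos_of_ne_zero hN0; positivity
    have hr' : (r : ℝ) ≠ 0 := by exact_mod_cast hr
    refine ⟨√((q : ℝ) / N) / r, div_ne_zero (Real.sqrt_pos.2 hpos).ne' hr', ?_⟩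
    rw [div_pow, Real.sq_sqrt hpos.le, e0]
    push_cast
    field_simp
  · intro p hp hpS
    have hnN : ‖(N : ℚ_[p])‖ = 1 := norm_natCast_one (hNS p hpS)
    have hNp : (N : ℚ_[p]) ≠ 0 := by exact_mod_cast hN0
    have hqp : (q : ℚ_[p]) ≠ 0 := by exact_mod_cast hq.ne_zero
    have hr' : (r : ℚ_[p]) ≠ 0 := by exact_mod_cast hr
    have h2p : (0 : ℝ) < ‖(2 : ℚ_[p])‖ := norm_pos_iff.2 two_ne_zero
    have h2le : ‖(2 : ℚ_[p])‖ ≤ 1 := by simpa using Padic.norm_int_le_one (p := p) 2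
    obtain ⟨k, hk⟩ := (Nat.modEq_iff_dvd.1 hmod.symm)
    have hk' : (q : ℚ_[p]) - N = 2 ^ 3 * P * k := by
      have := congrArg (fun z : ℤ => (z : ℚ_[p])) hk
      push_cast at this
      rw [this]; ring
    have hPl : ‖(P : ℚ_[p])‖ < 1 := Padic.norm_natCast_lt_one_iff.2 (hdvdP p hpS)
    have hkl : ‖(k : ℚ_[p])‖ ≤ 1 := Padic.norm_int_le_one k
    have hlt : ‖(q : ℚ_[p]) / N - 1‖ < ‖(2 : ℚ_[p])‖ ^ 2 := by
      rw [div_sub_one hNp, norm_div, hnN, div_one, hk', norm_mul, norm_mul, norm_pow]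
      have h3 : ‖(2 : ℚ_[p])‖ ^ 3 ≤ ‖(2 : ℚ_[p])‖ ^ 2 :=
        pow_le_pow_of_le_one h2p.le h2le (by norm_num)
      have h4 : ‖(P : ℚ_[p])‖ * ‖(k : ℚ_[p])‖ < 1 := by
        nlinarith [norm_nonneg (P : ℚ_[p]), norm_nonneg (k : ℚ_[p])]
      have h5 : 0 < ‖(2 : ℚ_[p])‖ ^ 3 := by positivity
      rw [mul_assoc]
      nlinarith
    obtain ⟨σ, hσ⟩ := isSquare_near_one hlt
    have hσ0 : σ ≠ 0 := by
      rintro rfl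
      rw [mul_zero] at hσ
      exact div_ne_zero hqp hNp hσ
    refine ⟨σ / r, div_ne_zero hσ0 hr', ?_⟩
    rw [e0]
    push_cast
    rw [hσ]
    field_simp
  · intro p hp hpS hpq
    have hNp : (N : ℚ_[p]) ≠ 0 := by exact_mod_cast hN0
    have hn : ‖(t1 : ℚ_[p])‖ = ‖(s : ℚ_[p])‖ * ‖(N : ℚ_[p])‖ := by
      rw [← norm_mul, ← Nat.cast_mul, ← hN]
      rcases Int.natAbs_eq t1 with e | e
      · conv_lhs => rw [e]
        simp
      · conv_lhs => rw [e]
        simp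
    have h1 : ‖(s : ℚ_[p])‖ = 1 := norm_natCast_one fun h =>
      hpS (hmem p hp.1 (h.trans (Nat.gcd_dvd_right _ _)))
    have h3 : ‖(q : ℚ_[p])‖ = 1 := norm_natCast_one fun h =>
      hpq ((Nat.prime_dvd_prime_iff_eq hp.1 hq).1 h)
    push_cast
    rw [norm_mul, norm_div, hn, h1, h3]
    field_simp [norm_ne_zero_iff.2 hNp]

lemma local_split {m : ℕ} (hm : 0 < m) (a : Fin (m + 2) → ℚ) (ha : ∀ i, a i ≠ 0) (h : LocD a)
    (S : Finset ℕ) (hS : ∀ p ∈ S, p.Prime) :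
    ∃ X Y : ℚ, a 0 * X ^ 2 + a 1 * Y ^ 2 ≠ 0 ∧
      (∃ w : Fin m → ℝ, ∑ i, (a i.succ.succ : ℝ) * w i ^ 2 = -((a 0 * X ^ 2 + a 1 * Y ^ 2 : ℚ) : ℝ)) ∧
      ∀ (p : ℕ) (_ : Fact p.Prime), p ∈ S → ∃ w : Fin m → ℚ_[p],
        ∑ i, (a i.succ.succ : ℚ_[p]) * w i ^ 2 = -((a 0 * X ^ 2 + a 1 * Y ^ 2 : ℚ) : ℚ_[p]) := by
  obtain ⟨hR, hP⟩ := h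
  obtain ⟨xr, yr, wr, h0r, hwr⟩ := split_two hm (fun i => by exact_mod_cast ha i) hR
  have hP' := fun p hp => split_two hm (fun i => by exact_mod_cast ha i) (hP p hp)
  choose x y w h0 hw using hP'
  obtain ⟨X, Y, ⟨s, hs, e⟩, hXY⟩ := approx_sq S hS (a 0) (a 1) xr yr x y h0r h0
  refine ⟨X, Y, ?_, ?_, ?_⟩
  · intro hc
    rw [hc, Rat.cast_zero] at e
    exact mul_ne_zero h0r (pow_ne_zero 2 hs) e.symm
  · refine ⟨fun i => wr i * s, ?_⟩
    rw [e, ← neg_mul, ← hwr, Finset.sum_mul]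
    exact Finset.sum_congr rfl fun i _ => by ring
  · intro p hp hpS
    obtain ⟨s, hs, e⟩ := hXY p hp hpS
    refine ⟨fun i => w p hp i * s, ?_⟩
    rw [e, ← neg_mul, ← hw p hp, Finset.sum_mul]
    exact Finset.sum_congr rfl fun i _ => by ring

section
variable {K : Type*} [Field K]

lemma DIso.of_tern {k : ℕ} {h : Fin (k + 3) → K} (ht : Tern K (h 0) (h 1) (h 2)) : DIso K h := by
  obtain ⟨x, y, z, h0, e⟩ := ht
  refine ⟨Fin.cons x (Fin.cons y (Fin.cons z 0)), ?_, ?_⟩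
  · intro hc
    have h1 := congrFun hc 0
    have h2 := congrFun hc (Fin.succ 0)
    have h3 := congrFun hc (Fin.succ (Fin.succ 0))
    simp only [Fin.cons_zero, Fin.cons_succ, Pi.zero_apply] at h1 h2 h3
    simp_all
  · rw [Fin.sum_univ_succ, Fin.sum_univ_succ, Fin.sum_univ_succ]
    simp only [Fin.cons_zero, Fin.cons_succ, Pi.zero_apply]
    simp only [ne_eq, OfNat.ofNat_ne_zero, not_false_eq_true, zero_pow, mul_zero,
      Finset.sum_const_zero, add_zero]
    have : (Fin.succ (Fin.succ 0) : Fin (k + 3)) = 2 := rfl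
    rw [this]
    have : (Fin.succ 0 : Fin (k + 3)) = 1 := rfl
    rw [this]
    linear_combination e

lemma DIso.tern {h : Fin 3 → K} (hd : DIso K h) : Tern K (h 0) (h 1) (h 2) := by
  obtain ⟨v, hv, e⟩ := hd
  refine ⟨v 0, v 1, v 2, ?_, by rw [Fin.sum_univ_three] at e; exact e⟩
  by_contra! hc
  exact hv (funext fun i => by fin_cases i <;> simp [hc])

lemma DIso.tail {n : ℕ} {h : Fin (n + 1) → K} (hd : DIso K (fun i : Fin n => h i.succ)) :
    DIso K h := by
  obtain ⟨v, hv, e⟩ := hd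
  refine ⟨Fin.cons 0 v, ?_, ?_⟩
  · intro hc
    exact hv (funext fun i => by simpa using congrFun hc i.succ)
  · rw [Fin.sum_univ_succ]; simpa using e

lemma DIso.of_rep {m : ℕ} {h : Fin (m + 1) → K} {w : Fin m → K}
    (e : ∑ i, h i.succ * w i ^ 2 = -h 0) : DIso K h := by
  refine ⟨Fin.cons 1 w, fun hc => by simpa using congrFun hc 0, ?_⟩
  rw [Fin.sum_univ_succ]; simp [e]
end

lemma step5 {k : ℕ} (ih : ∀ a : Fin (k + 4) → ℚ, (∀ i, a i ≠ 0) → LocD a → DIso ℚ a)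
    (a : Fin (k + 5) → ℚ) (ha : ∀ i, a i ≠ 0) (h : LocD a) : DIso ℚ a := by
  obtain ⟨S, hS, h2, hn⟩ := bad_primes a ha
  obtain ⟨X, Y, ht, hR, hP⟩ := local_split (m := k + 3) (by omega) a ha h S hS
  set t := a 0 * X ^ 2 + a 1 * Y ^ 2 with htd
  have := ih (Fin.cons t fun i => a i.succ.succ) (by
    intro i; refine Fin.cases ht (fun j => ?_) i; simpa using ha _) (by
    constructor
    · obtain ⟨w, hw⟩ := hR
      exact DIso.of_rep (w := w) (by simpa using hw)
    · intro p hp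
      by_cases hpS : p ∈ S
      · obtain ⟨w, hw⟩ := hP p hp hpS
        exact DIso.of_rep (w := w) (by simpa using hw)
      · apply DIso.tail
        apply DIso.of_tern
        simp only [Fin.cons_succ]
        exact tern_unit (fun h => hpS (h ▸ h2)) (hn p hp hpS _) (hn p hp hpS _) (hn p hp hpS _))
  obtain ⟨v, hv, e⟩ := this
  rw [Fin.sum_univ_succ] at e
  simp only [Fin.cons_zero, Fin.cons_succ] at e
  by_cases h0 : v 0 = 0
  · refine ⟨Fin.cons 0 (Fin.cons 0 fun i => v i.succ), ?_, ?_⟩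
    · intro hc
      refine hv (funext fun i => Fin.cases h0 (fun j => ?_) i)
      simpa using congrFun hc j.succ.succ
    · rw [Fin.sum_univ_succ, Fin.sum_univ_succ]
      simpa [h0] using e
  · refine ⟨Fin.cons (v 0 * X) (Fin.cons (v 0 * Y) fun i => v i.succ), ?_, ?_⟩
    · intro hc
      have h1 := congrFun hc 0
      have h3 := congrFun hc (Fin.succ 0)
      simp only [Fin.cons_zero, Fin.cons_succ, Pi.zero_apply, mul_eq_zero, h0, false_or] at h1 h3
      rw [h1, h3] at htd
      exact ht (by rw [htd]; ring)
    · rw [Fin.sum_univ_succ, Fin.sum_univ_succ]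
      simp only [Fin.cons_zero, Fin.cons_succ]
      simp only [Fin.succ_zero_eq_one]
      rw [htd] at e
      linear_combination e

lemma case4 (a : Fin 4 → ℚ) (ha : ∀ i, a i ≠ 0) (h : LocD a) : DIso ℚ a := by
  obtain ⟨S, hS, h2, hn⟩ := bad_primes a ha
  obtain ⟨X, Y, ht0, ⟨wr, hR⟩, hP⟩ := local_split (m := 2) (by omega) a ha h S hS
  set t0 := a 0 * X ^ 2 + a 1 * Y ^ 2 with htd
  obtain ⟨t, q, ht, hq, hqS, ⟨σ, hσ, eσ⟩, hσS, hσn⟩ := dirichlet_adjust t0 ht0 S hS h2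
  have hq2 : q ≠ 2 := fun h => hqS (h ▸ h2)
  have e2 : (Fin.succ (Fin.succ 0) : Fin 4) = 2 := rfl
  have e3 : (Fin.succ (Fin.succ 1) : Fin 4) = 3 := rfl
  have gen1 : ∀ (K : Type) [Field K] [CharZero K] (σ : K), σ ≠ 0 → (t : K) = t0 * σ ^ 2 →
      Tern K (a 0 : ℚ) (a 1 : ℚ) ((-t : ℚ) : K) := by
    intro K _ _ σ hσ e
    have : Tern K (a 0 : ℚ) (a 1 : ℚ) ((-t0 : ℚ) : K) :=
      ⟨X, Y, 1, by simp, by rw [htd]; push_cast; ring⟩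
    have := this.sq3 hσ
    push_cast at this ⊢
    rw [e]
    simpa using this
  have gen2 : ∀ (K : Type) [Field K] [CharZero K] (σ : K) (w : Fin 2 → K), σ ≠ 0 →
      (t : K) = t0 * σ ^ 2 → ∑ i, (a i.succ.succ : K) * w i ^ 2 = -(t0 : K) →
      Tern K (a 2 : ℚ) (a 3 : ℚ) (t : K) := by
    intro K _ _ σ w hσ e hw
    rw [Fin.sum_univ_two, e2, e3] at hw
    have : Tern K (a 2 : ℚ) (a 3 : ℚ) (t0 : K) := ⟨w 0, w 1, 1, by simp, by linear_combination hw⟩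
    rw [e]
    exact this.sq3 hσ
  have L1 : LocT q (a 0) (a 1) (-t) := by
    refine ⟨gen1 ℝ σ hσ eσ, fun p hp hpq => ?_⟩
    by_cases hpS : p ∈ S
    · obtain ⟨σ, hσ, eσ⟩ := hσS p hp hpS
      exact gen1 _ σ hσ eσ
    · refine tern_unit (fun h => hpS (h ▸ h2)) (hn p hp hpS _) (hn p hp hpS _) ?_
      push_cast
      rw [norm_neg]
      exact hσn p hp hpS hpq
  have L2 : LocT q (a 2) (a 3) t := by
    refine ⟨gen2 ℝ σ wr hσ eσ hR, fun p hp hpq => ?_⟩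
    by_cases hpS : p ∈ S
    · obtain ⟨σ, hσ, eσ⟩ := hσS p hp hpS
      obtain ⟨w, hw⟩ := hP p hp hpS
      exact gen2 _ σ w hσ eσ hw
    · exact tern_unit (fun h => hpS (h ▸ h2)) (hn p hp hpS _) (hn p hp hpS _) (hσn p hp hpS hpq)
  have T1 := tern_hasse hq hq2 (ha 0) (ha 1) (neg_ne_zero.2 ht) L1
  have T2 := tern_hasse hq hq2 (ha 2) (ha 3) ht L2
  obtain ⟨x, y, h1⟩ := tern_rep (ha 0) (ha 1) T1
  obtain ⟨z, u, h3⟩ := tern_rep (t := -t) (ha 2) (ha 3) (by rwa [neg_neg])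
  refine ⟨![x, y, z, u], ?_, ?_⟩
  · intro hc
    have hx : x = 0 := by simpa using congrFun hc 0
    have hy : y = 0 := by simpa using congrFun hc 1
    rw [hx, hy] at h1
    exact ht (by rw [← h1]; ring)
  · rw [Fin.sum_univ_four]
    simp
    linear_combination h1 + h3

lemma case2 (a : Fin 2 → ℚ) (ha : ∀ i, a i ≠ 0) (h : LocD a) : DIso ℚ a := by
  obtain ⟨d, s, hsf, hs, e⟩ := rat_sqfree (-(a 0 * a 1))
    (neg_ne_zero.2 (mul_ne_zero (ha 0) (ha 1)))
  have key : ∀ (K : Type) [Field K] [CharZero K], DIso K (fun i => (a i : K)) →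
      ∃ z : K, (d : K) = z ^ 2 := by
    intro K _ _ ⟨v, hv, hw⟩
    rw [Fin.sum_univ_two] at hw
    have e' := congrArg (fun z : ℚ => (z : K)) e
    push_cast at e'
    have hs' : (s : K) ≠ 0 := by exact_mod_cast hs
    have h0 : (a 0 : K) ≠ 0 := by exact_mod_cast ha 0
    have h1 : (a 1 : K) ≠ 0 := by exact_mod_cast ha 1
    have hv1 : v 1 ≠ 0 := by
      intro h
      rw [h] at hw
      have : v 0 = 0 := by simpa [h0] using hw
      exact hv (funext fun i => by fin_cases i <;> simp [h, this])
    refine ⟨a 0 * v 0 / (v 1 * s), ?_⟩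
    rw [div_pow, eq_div_iff (pow_ne_zero _ (mul_ne_zero hv1 hs'))]
    linear_combination (-v 1 ^ 2) * e' - a 0 * hw
  have hpos : 0 < d := by
    obtain ⟨z, hz⟩ := key ℝ h.1
    have : (0 : ℝ) ≤ d := by rw [hz]; positivity
    have : 0 ≤ d := by exact_mod_cast this
    exact lt_of_le_of_ne this hsf.ne_zero.symm
  have hd1 : d = 1 := by
    by_contra hd
    have hna : d.natAbs ≠ 1 := by omega
    obtain ⟨p, hp, hpd⟩ := Nat.exists_prime_and_dvd hna
    have hF : Fact p.Prime := ⟨hp⟩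
    obtain ⟨z, hz⟩ := key ℚ_[p] (h.2 p hF)
    have hpd' : (p : ℤ) ∣ d := Int.natCast_dvd.2 hpd
    obtain ⟨m, hm⟩ := hpd'
    have hpm : ¬ (p : ℤ) ∣ m := by
      intro hc
      have : (p : ℤ) * p ∣ d := hm ▸ mul_dvd_mul_left _ hc
      have := hsf _ this
      exact (Nat.prime_iff_prime_int.1 hp).not_isUnit this
    have hm1 : ‖(m : ℚ_[p])‖ = 1 := by
      refine le_antisymm (Padic.norm_int_le_one m) (not_lt.1 fun hc => hpm ?_)
      exact Padic.norm_intCast_lt_one_iff.1 hc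
    have hnz : ‖(p : ℚ_[p])‖ = ‖z‖ ^ 2 := by
      rw [← norm_pow, ← hz, hm]
      push_cast
      rw [norm_mul, hm1, mul_one]
    have hz0 : z ≠ 0 := by
      rintro rfl
      have : (d : ℚ_[p]) = 0 := by rw [hz]; simp
      exact hsf.ne_zero (by exact_mod_cast this)
    rw [Padic.norm_eq_zpow_neg_valuation hz0, Padic.norm_p, ← zpow_neg_one, ← zpow_natCast,
      ← zpow_mul] at hnz
    have hp1 : (1 : ℝ) < p := by exact_mod_cast hp.one_lt
    have := zpow_right_injective₀ (by positivity) hp1.ne' hnz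
    push_cast at this
    omega
  rw [hd1] at e
  refine ⟨![s, a 0], ?_, ?_⟩
  · intro hc
    exact ha 0 (by simpa using congrFun hc 1)
  · rw [Fin.sum_univ_two]
    simp
    push_cast at e
    linear_combination (-a 0) * e

lemma case3 (a : Fin 3 → ℚ) (ha : ∀ i, a i ≠ 0) (h : LocD a) : DIso ℚ a :=
  DIso.of_tern (tern_hasse Nat.prime_three (by norm_num) (ha 0) (ha 1) (ha 2)
    ⟨h.1.tern, fun p hp _ => (h.2 p hp).tern⟩)

lemma diag_hasse : ∀ {n : ℕ} (a : Fin n → ℚ), (∀ i, a i ≠ 0) → LocD a → DIso ℚ a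
  | 0, a, ha, h => by
    obtain ⟨⟨v, hv, _⟩, _⟩ := h
    exact absurd (Subsingleton.elim _ _) hv
  | 1, a, ha, h => by
    obtain ⟨⟨v, hv, e⟩, _⟩ := h
    have h0 : (a 0 : ℝ) ≠ 0 := by exact_mod_cast ha 0
    refine absurd (funext fun i => ?_) hv
    have : i = 0 := Subsingleton.elim _ _
    subst this
    simpa [h0] using e
  | 2, a, ha, h => case2 a ha h
  | 3, a, ha, h => case3 a ha h
  | 4, a, ha, h => case4 a ha h
  | k + 5, a, ha, h => step5 (k := k) (fun a => diag_hasse a) a ha h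


section diag
variable {n : ℕ}

lemma quad_expand {K : Type*} [Field K] (w : Fin n → K) (M : Matrix (Fin n) (Fin n) K)
    (v : Fin n → K) : ∑ k, w k * (M.mulVec v k) ^ 2 =
      ∑ i, ∑ j, (∑ k, w k * M k i * M k j) * v i * v j := by
  have : ∀ k, w k * (M.mulVec v k) ^ 2 = ∑ i, ∑ j, w k * M k i * M k j * v i * v j := by
    intro k
    rw [Matrix.mulVec, dotProduct, sq, Finset.sum_mul_sum, Finset.mul_sum]
    refine Finset.sum_congr rfl fun i _ => ?_
    rw [Finset.mul_sum]
    exact Finset.sum_congr rfl fun j _ => by ring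
  simp_rw [this]
  rw [Finset.sum_comm]
  refine Finset.sum_congr rfl fun i _ => ?_
  rw [Finset.sum_comm]
  refine Finset.sum_congr rfl fun j _ => ?_
  rw [Finset.sum_mul, Finset.sum_mul]

lemma quad_symm {K : Type*} [Field K] [CharZero K] (c d : Fin n → Fin n → K)
    (h : ∀ i j, c i j + c j i = d i j + d j i) (v : Fin n → K) :
    ∑ i, ∑ j, c i j * v i * v j = ∑ i, ∑ j, d i j * v i * v j := by
  have key : ∀ c : Fin n → Fin n → K, 2 * ∑ i, ∑ j, c i j * v i * v j =
      ∑ i, ∑ j, (c i j + c j i) * v i * v j := by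
    intro c
    have : ∑ i, ∑ j, c i j * v i * v j = ∑ i, ∑ j, c j i * v i * v j := by
      rw [Finset.sum_comm]
      exact Finset.sum_congr rfl fun i _ => Finset.sum_congr rfl fun j _ => by ring
    rw [two_mul]
    nth_rw 2 [this]
    simp_rw [← Finset.sum_add_distrib]
    exact Finset.sum_congr rfl fun i _ => Finset.sum_congr rfl fun j _ => by ring
  have := (key c).trans ((by simp_rw [h] : _ = _).trans (key d).symm)
  exact mul_left_cancel₀ two_ne_zero this

lemma quad_coeff (c : Fin n → Fin n → ℚ) (i j : Fin n) :
    c i j + c j i = (∑ k, ∑ l, c k l * (Pi.single i 1 + Pi.single j 1 : Fin n → ℚ) k *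
        (Pi.single i 1 + Pi.single j 1 : Fin n → ℚ) l)
      - (∑ k, ∑ l, c k l * (Pi.single i 1 : Fin n → ℚ) k * (Pi.single i 1 : Fin n → ℚ) l)
      - (∑ k, ∑ l, c k l * (Pi.single j 1 : Fin n → ℚ) k * (Pi.single j 1 : Fin n → ℚ) l) := by
  simp only [Pi.add_apply, mul_add, add_mul, Finset.sum_add_distrib]
  simp [Pi.single_apply]
  ring

lemma diagonalize (c : Fin n → Fin n → ℚ) : ∃ (w : Fin n → ℚ) (M N : Matrix (Fin n) (Fin n) ℚ),
    M * N = 1 ∧ N * M = 1 ∧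
    ∀ i j, c i j + c j i = (∑ k, w k * M k i * M k j) + ∑ k, w k * M k j * M k i := by
  let Q : QuadraticForm ℚ (Fin n → ℚ) := (Matrix.of c).toQuadraticForm'
  have hQ : ∀ v, Q v = ∑ i, ∑ j, c i j * v i * v j := by
    intro v
    simp only [Q, Matrix.toQuadraticForm']
    rw [LinearMap.BilinMap.toQuadraticMap_apply, Matrix.toLinearMap₂'_apply]
    refine Finset.sum_congr rfl fun i _ => Finset.sum_congr rfl fun j _ => ?_
    simp
    ring
  obtain ⟨w, ⟨f⟩⟩ : ∃ w : Fin n → ℚ, QuadraticMap.Equivalent Q (QuadraticMap.weightedSumSquares ℚ w) := by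
    have := QuadraticForm.equivalent_weightedSumSquares Q
    rwa [Module.finrank_fin_fun] at this
  let e : (Fin n → ℚ) ≃ₗ[ℚ] (Fin n → ℚ) := f.toLinearEquiv
  refine ⟨w, LinearMap.toMatrix' e.toLinearMap, LinearMap.toMatrix' e.symm.toLinearMap, ?_, ?_, ?_⟩
  · rw [← LinearMap.toMatrix'_comp]; simp
  · rw [← LinearMap.toMatrix'_comp]; simp
  · have H : ∀ v : Fin n → ℚ, ∑ i, ∑ j, c i j * v i * v j = ∑ i, ∑ j,
        (∑ k, w k * LinearMap.toMatrix' e.toLinearMap k i * LinearMap.toMatrix' e.toLinearMap k j)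
          * v i * v j := by
      intro v
      rw [← quad_expand, ← hQ, ← f.map_app v, QuadraticMap.weightedSumSquares_apply]
      refine Finset.sum_congr rfl fun k _ => ?_
      rw [LinearMap.toMatrix'_mulVec, smul_eq_mul, sq]
      rfl
    intro i j
    rw [quad_coeff c i j, H, H, H, ← quad_coeff]

end diag

lemma map_one_mul {K : Type*} [Field K] [CharZero K] {n : ℕ} {M N : Matrix (Fin n) (Fin n) ℚ}
    (h : M * N = 1) : (M.map (Rat.castHom K)) * (N.map (Rat.castHom K)) = 1 := by
  rw [← Matrix.map_mul, h, Matrix.map_one _ (map_zero _) (map_one _)]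

lemma iso_iff {K : Type*} [Field K] [CharZero K] {n : ℕ} {c : Fin n → Fin n → ℚ} {w : Fin n → ℚ}
    {M N : Matrix (Fin n) (Fin n) ℚ} (h1 : M * N = 1) (h2 : N * M = 1)
    (h : ∀ i j, c i j + c j i = (∑ k, w k * M k i * M k j) + ∑ k, w k * M k j * M k i) :
    (∃ v : Fin n → K, v ≠ 0 ∧ ∑ i, ∑ j, (c i j : K) * v i * v j = 0) ↔
      DIso K (fun i => (w i : K)) := by
  have H : ∀ v : Fin n → K, ∑ i, ∑ j, (c i j : K) * v i * v j =
      ∑ k, (w k : K) * ((M.map (Rat.castHom K)).mulVec v k) ^ 2 := by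
    intro v
    rw [quad_expand]
    apply quad_symm (fun i j => (c i j : K))
      (fun i j => ∑ k, (w k : K) * M.map (Rat.castHom K) k i * M.map (Rat.castHom K) k j)
    intro i j
    have := congrArg (fun z : ℚ => (z : K)) (h i j)
    push_cast at this
    simpa using this
  constructor
  · rintro ⟨v, hv, e⟩
    refine ⟨(M.map (Rat.castHom K)).mulVec v, fun hc => hv ?_, (H v) ▸ e⟩
    have := congrArg (N.map (Rat.castHom K)).mulVec hc
    rwa [Matrix.mulVec_mulVec, map_one_mul h2, Matrix.one_mulVec, Matrix.mulVec_zero] at this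
  · rintro ⟨u, hu, e⟩
    have hMN : (M.map (Rat.castHom K)).mulVec ((N.map (Rat.castHom K)).mulVec u) = u := by
      rw [Matrix.mulVec_mulVec, map_one_mul h1, Matrix.one_mulVec]
    refine ⟨(N.map (Rat.castHom K)).mulVec u, fun hc => hu ?_, ?_⟩
    · rw [← hMN, hc, Matrix.mulVec_zero]
    · rw [H, hMN]; exact e

lemma cast_iso (K : Type*) [Field K] [CharZero K] {n : ℕ} {c : Fin n → Fin n → ℚ}
    (h : ∃ v : Fin n → ℚ, v ≠ 0 ∧ ∑ i, ∑ j, c i j * v i * v j = 0) :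
    ∃ v : Fin n → K, v ≠ 0 ∧ ∑ i, ∑ j, (c i j : K) * v i * v j = 0 := by
  obtain ⟨v, hv, e⟩ := h
  refine ⟨fun i => (v i : K), fun hc => hv (funext fun i => ?_), ?_⟩
  · have := congrFun hc i
    simpa using this
  · have := congrArg (fun z : ℚ => (z : K)) e
    push_cast at this
    exact this

/-- Hasse–Minkowski over ℚ for a quadratic form given by a coefficient matrix
`c : Fin n → Fin n → ℚ`, `F(v) = ∑ i j, c i j * v i * v j`. -/
theorem hasse_minkowski_rat {n : ℕ} (c : Fin n → Fin n → ℚ) :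
    (∃ v : Fin n → ℚ, v ≠ 0 ∧ ∑ i, ∑ j, c i j * v i * v j = 0) ↔
      (∃ v : Fin n → ℝ, v ≠ 0 ∧ ∑ i, ∑ j, (c i j : ℝ) * v i * v j = 0) ∧
        ∀ (p : ℕ) (_ : Fact p.Prime),
          ∃ v : Fin n → ℚ_[p], v ≠ 0 ∧ ∑ i, ∑ j, (c i j : ℚ_[p]) * v i * v j = 0 := by
  constructor
  · intro h
    exact ⟨cast_iso ℝ h, fun p _ => cast_iso ℚ_[p] h⟩
  · rintro ⟨hR, hP⟩
    obtain ⟨w, M, N, h1, h2, h⟩ := diagonalize c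
    have hQ : DIso ℚ w := by
      by_cases hw : ∀ i, w i ≠ 0
      · exact diag_hasse w hw ⟨(iso_iff h1 h2 h).1 hR, fun p hp => (iso_iff h1 h2 h).1 (hP p hp)⟩
      · push Not at hw
        obtain ⟨i, hi⟩ := hw
        refine ⟨Pi.single i 1, by simp, ?_⟩
        rw [Finset.sum_eq_single i]
        · simp [hi]
        · intro j _ hj; simp [hj]
        · simp
    have := (iso_iff (K := ℚ) h1 h2 h).2 (by simpa using hQ)
    simpa using this
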